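/- Let R be a pairing relation on E = {±e_1, ±e_2, ±e_3} satisfying (P). A set ℰ of curves is locally isomorphic to Ĉ_R if and only if either (1) ℰ is isomorphic to Ĉ_S for some pairing relation S satisfying (P), or (2) ℰ is isomorphic to Ĉ_X for some sequence X = (x_s)_{s∈ℕ*} ⊆ ℤ^3 with x_{s+1} − x_s ∈ 2^{s+1}ℤ^3 for all s and ⋂_{s∈ℕ*} (x_s + 2^{s+1}ℤ^3) = ∅. -/

import Mathlib

namespace Folding

noncomputable section

open Set

/-- Points of `ℝ^n` with the euclidean distance. -/
abbrev Pt (n : ℕ) := EuclideanSpace ℝ (Fin n)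

/-- `p` is a point of the lattice `ℤ^n`. -/
def latt {n : ℕ} (p : Pt n) : Prop := ∀ i, ∃ m : ℤ, p i = (m : ℝ)

/-- `p` belongs to `m·ℤ^n`. -/
def inLat {n : ℕ} (m : ℕ) (p : Pt n) : Prop := ∀ i, ∃ c : ℤ, p i = (m : ℝ) * (c : ℝ)

/-- The canonical basis vector `e_i`. -/
def uvec (n : ℕ) (i : Fin n) : Pt n := EuclideanSpace.single i (1 : ℝ)

/-- `u` belongs to `E = {e_1, -e_1, …, e_n, -e_n}`. -/
def IsDir {n : ℕ} (u : Pt n) : Prop := ∃ i, u = uvec n i ∨ u = -uvec n i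

/-- A (nonoriented) lattice segment `[x, x + e_i]`, as an unordered pair of endpoints. -/
def IsSeg {n : ℕ} (S : Sym2 (Pt n)) : Prop := ∃ x i, latt x ∧ S = s(x, x + uvec n i)

/-- A curve: a sequence of segments, indexed by an interval of `ℤ` (finite, ℕ-like or ℤ-like),
recorded through its sequence of vertices; two consecutive segments have exactly one common
endpoint, and the common endpoints with the preceding and the following segments differ
(`noback`). -/
structure Curve (n : ℕ) where
  dom : Set ℤ
  ordConn : dom.OrdConnected
  nontriv : ∃ i, i ∈ dom ∧ i + 1 ∈ dom
  v : ℤ → Pt n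
  lattice : ∀ i ∈ dom, latt (v i)
  step : ∀ i : ℤ, i ∈ dom → i + 1 ∈ dom →
    ∃ j, v (i + 1) = v i + uvec n j ∨ v (i + 1) = v i - uvec n j
  noback : ∀ i : ℤ, i - 1 ∈ dom → i + 1 ∈ dom → v (i + 1) ≠ v (i - 1)

namespace Curve

variable {n : ℕ} (c : Curve n)

/-- The segments of a curve. -/
def segs : Set (Sym2 (Pt n)) :=
  {S | ∃ i : ℤ, i ∈ c.dom ∧ i + 1 ∈ c.dom ∧ S = s(c.v i, c.v (i + 1))}

/-- The connexions between segments of a curve: pairs of consecutive segments. -/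
def conn (S T : Sym2 (Pt n)) : Prop :=
  ∃ i : ℤ, i - 1 ∈ c.dom ∧ i + 1 ∈ c.dom ∧
    ((S = s(c.v (i - 1), c.v i) ∧ T = s(c.v i, c.v (i + 1))) ∨
     (T = s(c.v (i - 1), c.v i) ∧ S = s(c.v i, c.v (i + 1))))

/-- A curve is self-avoiding if each of its segments appears only once. -/
def SelfAvoiding : Prop :=
  ∀ i j : ℤ, i ∈ c.dom → i + 1 ∈ c.dom → j ∈ c.dom → j + 1 ∈ c.dom →
    s(c.v i, c.v (i + 1)) = s(c.v j, c.v (j + 1)) → i = j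

/-- A curve without endpoints (indexed by `ℤ`). -/
def NoEndpts : Prop := c.dom = Set.univ

/-- `p` is an endpoint of the curve `c`. -/
def IsEndpt (p : Pt n) : Prop :=
  ∃ i ∈ c.dom, p = c.v i ∧ (i - 1 ∉ c.dom ∨ i + 1 ∉ c.dom)

/-- `S` is the end segment of `c` at its endpoint `p`. -/
def endSegAt (p : Pt n) (S : Sym2 (Pt n)) : Prop :=
  ∃ i : ℤ, i ∈ c.dom ∧ p = c.v i ∧
    ((i - 1 ∉ c.dom ∧ i + 1 ∈ c.dom ∧ S = s(c.v i, c.v (i + 1))) ∨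
     (i + 1 ∉ c.dom ∧ i - 1 ∈ c.dom ∧ S = s(c.v (i - 1), c.v i)))

/-- The number of segments (length) of a curve. -/
def nsegs : ℕ := {i : ℤ | i ∈ c.dom ∧ i + 1 ∈ c.dom}.ncard

end Curve

/-- The trace of a set of curves: its set of segments together with the connexion
relation between segments.  Two sets of curves are geometrically the same set of
(nonoriented) curves iff they have the same trace. -/
structure Trace (n : ℕ) where
  segs : Set (Sym2 (Pt n))
  conn : Sym2 (Pt n) → Sym2 (Pt n) → Prop

def curveTrace {n : ℕ} (c : Curve n) : Trace n := ⟨c.segs, c.conn⟩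

def traceOf {n : ℕ} (E : Set (Curve n)) : Trace n :=
  ⟨{S | ∃ c ∈ E, S ∈ c.segs}, fun S T => ∃ c ∈ E, c.conn S T⟩

/-- Two curves are the same nonoriented curve. -/
def SameCurve {n : ℕ} (c d : Curve n) : Prop := c.segs = d.segs ∧ c.conn = d.conn

/-- A set of pairwise disjoint self-avoiding curves. -/
def DisjSA {n : ℕ} (E : Set (Curve n)) : Prop :=
  (∀ c ∈ E, c.SelfAvoiding) ∧
  ∀ c ∈ E, ∀ d ∈ E, ¬ SameCurve c d → ∀ S, S ∈ c.segs → S ∉ d.segs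

/-- The set of points of `ℝ^n` lying on the segment `S`. -/
def segPts {n : ℕ} (S : Sym2 (Pt n)) : Set (Pt n) :=
  {p | ∃ a b, S = s(a, b) ∧ ∃ t : ℝ, 0 ≤ t ∧ t ≤ 1 ∧ p = a + t • (b - a)}

def Trace.pts {n : ℕ} (T : Trace n) : Set (Pt n) := ⋃ S ∈ T.segs, segPts S

/-- A set of curves covers `X ⊆ ℝ^n`: each lattice segment containing a point of `X`
appears in one and only one of the curves. -/
def Covers {n : ℕ} (E : Set (Curve n)) (X : Set (Pt n)) : Prop :=
  ∀ S, IsSeg S → (segPts S ∩ X).Nonempty →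
    (∃ c ∈ E, S ∈ c.segs) ∧ ∀ c ∈ E, ∀ d ∈ E, S ∈ c.segs → S ∈ d.segs → SameCurve c d

/-- A covering of `ℝ^n` by disjoint self-avoiding curves. -/
def IsCovering {n : ℕ} (E : Set (Curve n)) : Prop := DisjSA E ∧ Covers E Set.univ

/-- A single curve covers `X`. -/
def CurveCovers {n : ℕ} (c : Curve n) (X : Set (Pt n)) : Prop :=
  ∀ S, IsSeg S → (segPts S ∩ X).Nonempty → S ∈ c.segs

/-- `b` is a curve contained in the curve `a`. -/
def SubCurve {n : ℕ} (b a : Curve n) : Prop :=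
  b.segs ⊆ a.segs ∧ ∀ S T, b.conn S T → a.conn S T

/-- The relation `≺` at the level of traces. -/
def TPrec {n : ℕ} (T T' : Trace n) : Prop :=
  T.segs ⊆ T'.segs ∧ ∀ S S', T.conn S S' → T'.conn S S'

/-- `E ≺ F` : each segment of a curve of `E` is a segment of a curve of `F` and each
connexion between two segments of a curve of `E` also exists in `F`. -/
def Prec {n : ℕ} (E F : Set (Curve n)) : Prop := TPrec (traceOf E) (traceOf F)

/-- Image of a trace under a map of `ℝ^n`. -/
def Trace.map {n : ℕ} (f : Pt n → Pt n) (T : Trace n) : Trace n :=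
  ⟨Sym2.map f '' T.segs,
   fun S S' => ∃ A B, T.conn A B ∧ S = Sym2.map f A ∧ S' = Sym2.map f B⟩

/-- Translation of a trace by the vector `t`. -/
def Trace.transl {n : ℕ} (t : Pt n) (T : Trace n) : Trace n := T.map (fun p => p + t)

/-- Property (H) for the pair `(k, l)`. -/
def SatH {n : ℕ} (A : Set (Curve n)) (k l : ℕ) : Prop :=
  0 < k ∧ 0 < l ∧ k ∣ l ∧ IsCovering A ∧
  (∀ c ∈ A, c.dom.Finite ∧ ∃ x i, latt x ∧ inLat k x ∧ c.IsEndpt x ∧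
      c.IsEndpt (x + (k : ℝ) • uvec n i) ∧
      ∀ p, c.IsEndpt p → p = x ∨ p = x + (k : ℝ) • uvec n i) ∧
  (∀ (x : Pt n) (i : Fin n), latt x → inLat k x →
      (∃ c ∈ A, c.IsEndpt x ∧ c.IsEndpt (x + (k : ℝ) • uvec n i)) ∧
      ∀ c ∈ A, ∀ d ∈ A, c.IsEndpt x → c.IsEndpt (x + (k : ℝ) • uvec n i) →
        d.IsEndpt x → d.IsEndpt (x + (k : ℝ) • uvec n i) → SameCurve c d) ∧
  (∀ t : Pt n, inLat l t → Trace.transl t (traceOf A) = traceOf A)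

/-- The trace of the convolution product `A ∗ B`, where `A` satisfies (H) for `(k, l)`:
apply to `B` the homothety of center `0` and ratio `k`, then replace each resulting
segment by the curve of `A` having the same endpoints (connexions come from the curves
of `A`, together with the junctions of the end segments of consecutive `A`-curves). -/
def ConvTrace {n : ℕ} (k : ℕ) (A B : Set (Curve n)) : Trace n where
  segs := {S | ∃ a b : Pt n, s(a, b) ∈ (traceOf B).segs ∧
    ∃ c ∈ A, c.IsEndpt ((k : ℝ) • a) ∧ c.IsEndpt ((k : ℝ) • b) ∧ S ∈ c.segs}
  conn := fun S S' =>
    (∃ a b : Pt n, s(a, b) ∈ (traceOf B).segs ∧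
      ∃ c ∈ A, c.IsEndpt ((k : ℝ) • a) ∧ c.IsEndpt ((k : ℝ) • b) ∧ c.conn S S') ∨
    (∃ a b d : Pt n, (traceOf B).conn s(a, b) s(b, d) ∧
      ∃ c ∈ A, ∃ c' ∈ A, c.IsEndpt ((k : ℝ) • a) ∧ c.IsEndpt ((k : ℝ) • b) ∧
        c'.IsEndpt ((k : ℝ) • b) ∧ c'.IsEndpt ((k : ℝ) • d) ∧
        ((c.endSegAt ((k : ℝ) • b) S ∧ c'.endSegAt ((k : ℝ) • b) S') ∨
         (c.endSegAt ((k : ℝ) • b) S' ∧ c'.endSegAt ((k : ℝ) • b) S)))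

/-- The two-sided identity of the convolution product: the covering consisting of all
curves with one segment. -/
def unitTrace (n : ℕ) : Trace n := ⟨{S | IsSeg S}, fun _ _ => False⟩

/-- `P s` realizes the power `A^s` for the convolution product. -/
def PowersOf {n : ℕ} (A : Set (Curve n)) (k : ℕ) (P : ℕ → Set (Curve n)) : Prop :=
  (∀ s, DisjSA (P s)) ∧ traceOf (P 0) = unitTrace n ∧
  ∀ s, traceOf (P (s + 1)) = ConvTrace k A (P s)

/-- The trace of `Â`, the inductive limit of the `A^s` for `≺`. -/
def hatTrace {n : ℕ} (P : ℕ → Set (Curve n)) : Trace n :=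
  ⟨{S | ∃ s, S ∈ (traceOf (P s)).segs}, fun S T => ∃ s, (traceOf (P s)).conn S T⟩

/-- A pairing relation on `E = {e_1, -e_1, …, e_n, -e_n}`. -/
def IsPairing {n : ℕ} (R : Pt n → Pt n → Prop) : Prop :=
  (∀ u v, R u v → R v u) ∧ (∀ u v, R u v → IsDir u ∧ IsDir v) ∧
  (∀ u, ¬ R u u) ∧ ∀ u, IsDir u → ∃! v, R u v

/-- The trace of `Â_R` : `Â` with the segments with endpoint `0` connected according
to `R`. -/
def hatRTrace {n : ℕ} (P : ℕ → Set (Curve n)) (R : Pt n → Pt n → Prop) : Trace n :=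
  ⟨(hatTrace P).segs,
   fun S T => (hatTrace P).conn S T ∨
     ∃ u v, R u v ∧ S = s((0 : Pt n), u) ∧ T = s((0 : Pt n), v)⟩

/-- The cube `P_{x,h}`. -/
def cube {n : ℕ} (x : Pt n) (h : ℕ) : Set (Pt n) :=
  {p | ∀ i, x i - h ≤ p i ∧ p i ≤ x i + h}

/-- Restriction of a trace to a region `X` of `ℝ^n`. -/
def Trace.restr {n : ℕ} (T : Trace n) (X : Set (Pt n)) : Trace n :=
  ⟨{S | S ∈ T.segs ∧ segPts S ⊆ X},
   fun S S' => T.conn S S' ∧ segPts S ⊆ X ∧ segPts S' ⊆ X⟩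

/-- Condition (C). -/
def CondC {n : ℕ} (T : Trace n) : Prop :=
  ∀ (x : Pt n) (h : ℕ), latt x → 1 ≤ h →
    ∃ y : Pt n, latt y ∧ y ∉ cube x h ∧
      Trace.transl (y - x) (T.restr (cube x h)) = T.restr (cube y h)

/-- `(B(x,r) ∩ T, x) ≅ (B(y,r) ∩ T', y)` : the translation sending `x` to `y` maps
the part of `T` in the closed ball `B(x,r)` onto the part of `T'` in `B(y,r)`,
preserving the connexions between segments. -/
def BallIso {n : ℕ} (T : Trace n) (x : Pt n) (T' : Trace n) (y : Pt n) (r : ℝ) : Prop :=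
  (fun p => p + (y - x)) '' (T.pts ∩ Metric.closedBall x r) =
      T'.pts ∩ Metric.closedBall y r ∧
  (∀ S S', T.conn S S' → segPts S ⊆ Metric.closedBall x r →
      segPts S' ⊆ Metric.closedBall x r →
      T'.conn (Sym2.map (fun p => p + (y - x)) S) (Sym2.map (fun p => p + (y - x)) S')) ∧
  (∀ S S', T'.conn S S' → segPts S ⊆ Metric.closedBall y r →
      segPts S' ⊆ Metric.closedBall y r →
      T.conn (Sym2.map (fun p => p + (x - y)) S) (Sym2.map (fun p => p + (x - y)) S'))

/-- The local isomorphism property. -/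
def LocIsoProp {n : ℕ} (T : Trace n) : Prop :=
  ∀ (x : Pt n) (r : ℝ), 0 ≤ r →
    ∃ t : ℝ, 0 ≤ t ∧ ∀ y : Pt n, ∃ z ∈ Metric.closedBall y t, BallIso T x T z r

/-- Two traces are locally isomorphic. -/
def LocallyIso {n : ℕ} (T T' : Trace n) : Prop :=
  (∀ (x : Pt n) (r : ℝ), 0 ≤ r → ∃ y, BallIso T x T' y r) ∧
  (∀ (y : Pt n) (r : ℝ), 0 ≤ r → ∃ x, BallIso T' y T x r)

/-- `Ω_{s,x}` : suppress the connexions between segments whose common endpoint lies in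
`x + k^s ℤ^n`. -/
def OmegaTrace {n : ℕ} (k s : ℕ) (x : Pt n) (T : Trace n) : Trace n :=
  ⟨T.segs, fun S S' => T.conn S S' ∧ ¬ ∃ p, p ∈ S ∧ p ∈ S' ∧ inLat (k ^ s) (p - x)⟩

/-- `Σ_{s,x}(E)` : for each curve `D` of `E` passing through `x`, the curve(s) with
endpoint `x` contained in `D` having maximal length, this length being limited to
`8^s`. -/
def SigmaSet {n : ℕ} (s : ℕ) (x : Pt n) (E : Set (Curve n)) : Set (Curve n) :=
  {b | ∃ D ∈ E, SubCurve b D ∧ b.IsEndpt x ∧ b.nsegs ≤ 8 ^ s ∧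
    ∀ b' : Curve n, SubCurve b' D → b'.IsEndpt x → b'.nsegs ≤ 8 ^ s →
      SubCurve b b' → SameCurve b b'}

/-- A positive (orientation preserving) isometry of `ℝ^n`. -/
def PosIsom {n : ℕ} (f : Pt n → Pt n) : Prop :=
  ∃ (g : Pt n ≃ₗᵢ[ℝ] Pt n) (t : Pt n), (∀ x, f x = g x + t) ∧
    0 < LinearMap.det (g.toLinearEquiv.toLinearMap)

/-- `E` consists of exactly `m` curves. -/
def HasExactly {n : ℕ} (E : Set (Curve n)) (m : ℕ) : Prop :=
  ∃ L : List (Curve n), L.length = m ∧ (∀ c ∈ L, c ∈ E) ∧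
    L.Pairwise (fun c d => ¬ SameCurve c d) ∧ ∀ c ∈ E, ∃ d ∈ L, SameCurve c d

/-- `E` consists of at most `m` curves. -/
def AtMost {n : ℕ} (E : Set (Curve n)) (m : ℕ) : Prop :=
  ∃ L : List (Curve n), L.length ≤ m ∧ ∀ c ∈ E, ∃ d ∈ L, SameCurve c d

/-- The set of points of a curve. -/
def curvePts {n : ℕ} (c : Curve n) : Set (Pt n) := ⋃ S ∈ c.segs, segPts S

-- ℝ³-specific part
def toPt3 (f : Fin 3 → ℝ) : Pt 3 := (WithLp.equiv 2 (Fin 3 → ℝ)).symm f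

def p3 (a b c : ℤ) : Pt 3 := toPt3 ![(a : ℝ), (b : ℝ), (c : ℝ)]

/-- The vertices of the curve `C`. -/
def CList : List (Pt 3) :=
  [p3 0 0 0, p3 0 (-1) 0, p3 0 (-1) (-1), p3 0 0 (-1), p3 1 0 (-1),
   p3 1 (-1) (-1), p3 1 (-1) 0, p3 1 0 0, p3 2 0 0]

/-- The block `ℬ₀` : six curves given by their lists of successive vertices. -/
def B0 : List (List (Pt 3)) :=
  [ CList,
    [p3 0 0 0, p3 0 0 1, p3 0 1 1, p3 0 1 0, p3 (-1) 1 0, p3 (-1) 1 1,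
     p3 (-1) 0 1, p3 (-1) 0 0, p3 (-2) 0 0],
    [p3 0 0 0, p3 0 0 (-1), p3 (-1) 0 (-1), p3 (-1) 0 0, p3 (-1) 1 0,
     p3 (-1) 1 (-1), p3 0 1 (-1), p3 0 1 0, p3 0 2 0],
    [p3 0 0 0, p3 1 0 0, p3 1 0 1, p3 0 0 1, p3 0 (-1) 1, p3 1 (-1) 1,
     p3 1 (-1) 0, p3 0 (-1) 0, p3 0 (-2) 0],
    [p3 0 0 0, p3 (-1) 0 0, p3 (-1) (-1) 0, p3 0 (-1) 0, p3 0 (-1) 1,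
     p3 (-1) (-1) 1, p3 (-1) 0 1, p3 0 0 1, p3 0 0 2],
    [p3 0 0 0, p3 0 1 0, p3 1 1 0, p3 1 0 0, p3 1 0 (-1), p3 1 1 (-1),
     p3 0 1 (-1), p3 0 0 (-1), p3 0 0 (-2)] ]

def sigma3 : Pt 3 → Pt 3 := fun x => toPt3 ![x 0, -(x 1), -(x 2)]
def tau3 : Pt 3 → Pt 3 := fun x => toPt3 ![x 0, x 2, -(x 1)]
def ups3 : Pt 3 → Pt 3 := fun x => toPt3 ![x 0, -(x 2), x 1]

/-- The four blocks `ℬ₀, ℬ₁, ℬ₂, ℬ₃`. -/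
def blockLists : Fin 4 → List (List (Pt 3)) :=
  ![B0,
    B0.map (List.map fun p => p3 2 2 0 + sigma3 p),
    B0.map (List.map fun p => p3 2 0 2 + tau3 p),
    B0.map (List.map fun p => p3 0 2 2 + ups3 p)]

def listSegs (L : List (Pt 3)) : Set (Sym2 (Pt 3)) :=
  {S | ∃ j : ℕ, j + 1 < L.length ∧ S = s(L.getD j 0, L.getD (j + 1) 0)}

def listConn (L : List (Pt 3)) (S T : Sym2 (Pt 3)) : Prop :=
  ∃ j : ℕ, j + 2 < L.length ∧
    ((S = s(L.getD j 0, L.getD (j + 1) 0) ∧ T = s(L.getD (j + 1) 0, L.getD (j + 2) 0)) ∨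
     (T = s(L.getD j 0, L.getD (j + 1) 0) ∧ S = s(L.getD (j + 1) 0, L.getD (j + 2) 0)))

/-- The trace of the curve given by a list of successive vertices. -/
def listTrace (L : List (Pt 3)) : Trace 3 := ⟨listSegs L, listConn L⟩

/-- The trace of the covering `𝒞 = ⋃_{u ∈ ℤ³, 0 ≤ i ≤ 3} (4u + ℬ_i)`. -/
def CTrace : Trace 3 where
  segs := {S | ∃ u : Pt 3, latt u ∧ ∃ (i : Fin 4), ∃ M ∈ blockLists i,
    S ∈ (Trace.transl ((4 : ℝ) • u) (listTrace M)).segs}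
  conn := fun S T => ∃ u : Pt 3, latt u ∧ ∃ (i : Fin 4), ∃ M ∈ blockLists i,
    (Trace.transl ((4 : ℝ) • u) (listTrace M)).conn S T

open Classical in
/-- The permutation `θ` of `E` with `θ(e₁) = -e₂`, `θ(e₂) = -e₃`, `θ(e₃) = -e₁`
and `θ² = Id`. -/
def theta3 : Pt 3 → Pt 3 := fun u =>
  if u = uvec 3 0 then -uvec 3 1
  else if u = -uvec 3 1 then uvec 3 0
  else if u = uvec 3 1 then -uvec 3 2
  else if u = -uvec 3 2 then uvec 3 1
  else if u = uvec 3 2 then -uvec 3 0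
  else if u = -uvec 3 0 then uvec 3 2
  else u

/-- `R^θ`. -/
def Rtheta (R : Pt 3 → Pt 3 → Prop) : Pt 3 → Pt 3 → Prop :=
  fun u v => R (theta3 u) (theta3 v)

def Rx (P : ℕ → Set (Curve 3)) (x : Pt 3) : Pt 3 → Pt 3 → Prop :=
  fun u v => (hatTrace P).conn s(x, x + u) s(x, x + v)

/-- Condition (P). -/
def SatP (P : ℕ → Set (Curve 3)) (R : Pt 3 → Pt 3 → Prop) : Prop :=
  ∃ x : Pt 3, (∀ i, x i = -2 ∨ x i = 0 ∨ x i = 2 ∨ x i = 4) ∧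
    (¬ ∀ i, x i = 0 ∨ x i = 4) ∧ (Rx P x = R ∨ Rx P x = Rtheta R)

/-- The trace of `Ĉ_X`, the inductive limit of the sets `x_s + 𝒞^s`. -/
def hatXTrace (P : ℕ → Set (Curve 3)) (x : ℕ → Pt 3) : Trace 3 :=
  ⟨{S | ∃ s, 1 ≤ s ∧ S ∈ (Trace.transl (x s) (traceOf (P s))).segs},
   fun S T => ∃ s, 1 ≤ s ∧ (Trace.transl (x s) (traceOf (P s))).conn S T⟩

/-- The curve `c` is equivalent to `C` (image of `C` by a positive isometry). -/
def EquivToC (c : Curve 3) : Prop :=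
  ∃ f, PosIsom f ∧ curveTrace c = Trace.map f (listTrace CList)

/-- `x` is an endpoint of type `0` (resp. `1`) of the curve `c`, for `c`
equivalent to `C`. -/
def EndptType (c : Curve 3) (x : Pt 3) (ty : ℕ) : Prop :=
  ∃ f, PosIsom f ∧ curveTrace c = Trace.map f (listTrace CList) ∧
    x = f (if ty = 0 then p3 0 0 0 else p3 2 0 0)

/-- Integer points of `ℝ³`. -/
abbrev Z3 := Fin 3 → ℤ

/-- Labels for the six directions `±e_i`. -/
abbrev D6 := Fin 3 × Bool

def toPt (p : Z3) : Pt 3 := WithLp.toLp 2 fun i => (p i : ℝ)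

/-- The integer vector of a direction. -/
def dvec (d : D6) : Z3 := Pi.single d.1 (if d.2 then 1 else -1)

/-- The lattice segment issued from `p` in the direction `u`. -/
def edge (p : Z3) (u : D6) : Sym2 (Pt 3) := s(toPt p, toPt (p + dvec u))

def MulOf (m : ℤ) (p : Z3) : Prop := ∀ i, m ∣ p i

@[simp] lemma toPt_apply (p : Z3) (i : Fin 3) : toPt p i = p i := rfl

lemma toPt_inj {p q : Z3} : toPt p = toPt q ↔ p = q := by
  constructor
  · intro h
    funext i
    have := congrArg (fun x : Pt 3 => x i) h
    simpa using this
  · rintro rfl; rfl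

lemma toPt_add (p q : Z3) : toPt (p + q) = toPt p + toPt q := by
  ext i; simp

lemma toPt_sub (p q : Z3) : toPt (p - q) = toPt p - toPt q := by
  ext i; simp

lemma toPt_neg (p : Z3) : toPt (-p) = -toPt p := by
  ext i; simp

lemma toPt_zero : toPt 0 = 0 := by
  ext i; simp

lemma toPt_two_smul (p : Z3) : toPt (2 • p) = (2 : ℝ) • toPt p := by
  ext i; simp

lemma latt_toPt (p : Z3) : latt (toPt p) := fun i => ⟨p i, rfl⟩

lemma latt_iff {p : Pt 3} : latt p ↔ ∃ z, p = toPt z := by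
  constructor
  · intro h
    choose z hz using h
    exact ⟨z, by ext i; simp [hz]⟩
  · rintro ⟨z, rfl⟩; exact latt_toPt z

lemma inLat_toPt {m : ℕ} {p : Z3} : inLat m (toPt p) ↔ MulOf m p := by
  refine forall_congr' fun i => ?_
  constructor
  · rintro ⟨c, hc⟩
    refine ⟨c, ?_⟩
    have : ((p i : ℤ) : ℝ) = ((m * c : ℤ) : ℝ) := by simpa using hc
    exact_mod_cast this
  · rintro ⟨c, hc⟩
    exact ⟨c, by simp [hc]⟩

lemma inLat_latt {m : ℕ} {p : Pt 3} (h : inLat m p) : latt p := fun i => by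
  obtain ⟨c, hc⟩ := h i
  exact ⟨m * c, by simp [hc]⟩

lemma MulOf.exists_smul {p : Z3} (h : MulOf 2 p) : ∃ q : Z3, p = 2 • q := by
  choose q hq using h
  exact ⟨q, by funext i; simp [hq]⟩

lemma mulOf_two_smul (q : Z3) : MulOf 2 (2 • q) := fun i => ⟨q i, by simp⟩

lemma MulOf.add {m : ℤ} {p q : Z3} (hp : MulOf m p) (hq : MulOf m q) : MulOf m (p + q) :=
  fun i => dvd_add (hp i) (hq i)

lemma MulOf.sub {m : ℤ} {p q : Z3} (hp : MulOf m p) (hq : MulOf m q) : MulOf m (p - q) :=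
  fun i => dvd_sub (hp i) (hq i)

lemma MulOf.trans {m k : ℤ} {p : Z3} (hp : MulOf m p) (h : k ∣ m) : MulOf k p :=
  fun i => h.trans (hp i)

lemma mulOf_double {m : ℤ} {q : Z3} : MulOf (2 * m) (2 • q) ↔ MulOf m q := by
  refine forall_congr' fun i => ?_
  simp [mul_dvd_mul_iff_left]

lemma dvec_injective : Function.Injective dvec := by
  unfold Function.Injective; decide

lemma dvec_inj {u v : D6} : dvec u = dvec v ↔ u = v := dvec_injective.eq_iff

lemma dvec_ne_zero (u : D6) : dvec u ≠ 0 := by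
  revert u; decide

lemma uvec_eq (i : Fin 3) : uvec 3 i = toPt (dvec (i, true)) := by
  ext j; by_cases h : j = i
  · subst h; simp [uvec, dvec]
  · simp [uvec, dvec, h]

lemma neg_dvec (i : Fin 3) (b : Bool) : -dvec (i, b) = dvec (i, !b) := by
  revert i b; decide

lemma neg_uvec_eq (i : Fin 3) : -uvec 3 i = toPt (dvec (i, false)) := by
  rw [uvec_eq, ← toPt_neg, neg_dvec]; rfl

lemma isDir_iff {u : Pt 3} : IsDir u ↔ ∃ d, u = toPt (dvec d) := by
  constructor
  · rintro ⟨i, h | h⟩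
    · exact ⟨(i, true), by rw [h, uvec_eq]⟩
    · exact ⟨(i, false), by rw [h, neg_uvec_eq]⟩
  · rintro ⟨⟨i, b⟩, rfl⟩
    cases b
    · exact ⟨i, Or.inr (neg_uvec_eq i).symm⟩
    · exact ⟨i, Or.inl (uvec_eq i).symm⟩

/-- The opposite direction. -/
def opp (u : D6) : D6 := (u.1, !u.2)

lemma dvec_opp (u : D6) : dvec (opp u) = -dvec u := (neg_dvec u.1 u.2).symm

lemma edge_opp (p : Z3) (u : D6) : edge (p + dvec u) (opp u) = edge p u := by
  unfold edge
  rw [dvec_opp, add_neg_cancel_right, Sym2.eq_swap]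

lemma isSeg_edge (p : Z3) (u : D6) : IsSeg (edge p u) := by
  obtain ⟨i, b⟩ := u
  cases b
  · rw [← edge_opp]
    exact ⟨_, i, latt_toPt _, by rw [uvec_eq, ← toPt_add]; rfl⟩
  · exact ⟨_, i, latt_toPt p, by rw [uvec_eq, ← toPt_add]; rfl⟩

lemma isSeg_iff {S : Sym2 (Pt 3)} : IsSeg S ↔ ∃ p u, S = edge p u := by
  constructor
  · rintro ⟨x, i, hx, rfl⟩
    obtain ⟨z, rfl⟩ := latt_iff.1 hx
    exact ⟨z, (i, true), by rw [uvec_eq, ← toPt_add]; rfl⟩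
  · rintro ⟨p, u, rfl⟩; exact isSeg_edge p u

lemma edge_eq_iff {p q : Z3} {u v : D6} :
    edge p u = edge q v ↔ (p = q ∧ u = v) ∨ (p = q + dvec v ∧ p + dvec u = q) := by
  unfold edge
  rw [Sym2.eq_iff, toPt_inj, toPt_inj, toPt_inj, toPt_inj]
  constructor
  · rintro (⟨rfl, h⟩ | h)
    · exact Or.inl ⟨rfl, dvec_injective (add_left_cancel h)⟩
    · exact Or.inr h
  · rintro (⟨rfl, rfl⟩ | h)
    · exact Or.inl ⟨rfl, rfl⟩
    · exact Or.inr h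

lemma edge_inj {p : Z3} {u v : D6} : edge p u = edge p v ↔ u = v := by
  rw [edge_eq_iff]
  constructor
  · rintro (h | ⟨h, -⟩)
    · exact h.2
    · exact absurd (left_eq_add.1 h) (dvec_ne_zero v)
  · rintro rfl; exact Or.inl ⟨rfl, rfl⟩

/-- Two distinct segments issued from a common vertex determine it. -/
lemma edge_pair {p q : Z3} {u v a b : D6} (h : u ≠ v) (hu : edge p u = edge q a)
    (hv : edge p v = edge q b) : p = q ∧ u = a ∧ v = b := by
  rw [edge_eq_iff] at hu hv
  rcases hu with ⟨rfl, rfl⟩ | ⟨h1, h2⟩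
  · rcases hv with ⟨-, rfl⟩ | ⟨h1, h2⟩
    · exact ⟨rfl, rfl, rfl⟩
    · exact absurd (left_eq_add.1 h1) (dvec_ne_zero _)
  · rcases hv with ⟨rfl, rfl⟩ | ⟨h3, h4⟩
    · exact absurd (add_eq_left.1 h2) (dvec_ne_zero _)
    · exact absurd (dvec_injective (add_left_cancel (h2.trans h4.symm))) h

lemma mem_edge {x : Pt 3} {p : Z3} {u : D6} :
    x ∈ edge p u ↔ x = toPt p ∨ x = toPt (p + dvec u) := by
  unfold edge; exact Sym2.mem_iff

/-- A segment containing `p` is issued from `p`. -/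
lemma edge_of_mem {p q : Z3} {u : D6} (h : toPt p ∈ edge q u) : ∃ a, edge q u = edge p a := by
  rw [mem_edge, toPt_inj, toPt_inj] at h
  rcases h with rfl | rfl
  · exact ⟨u, rfl⟩
  · exact ⟨opp u, (edge_opp q u).symm⟩

lemma map_add_edge (p t : Z3) (u : D6) :
    Sym2.map (fun x => x + toPt t) (edge p u) = edge (p + t) u := by
  unfold edge
  rw [Sym2.map_mk, ← toPt_add, ← toPt_add, add_right_comm]

namespace Curve

lemma mem_dom_mid {n : ℕ} (c : Curve n) {i : ℤ} (h1 : i - 1 ∈ c.dom) (h2 : i + 1 ∈ c.dom) :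
    i ∈ c.dom :=
  c.ordConn.out h1 h2 ⟨by omega, by omega⟩

lemma exists_step (c : Curve 3) {i : ℤ} (h1 : i ∈ c.dom) (h2 : i + 1 ∈ c.dom) :
    ∃ p u, c.v i = toPt p ∧ c.v (i + 1) = toPt (p + dvec u) := by
  obtain ⟨p, hp⟩ := latt_iff.1 (c.lattice i h1)
  obtain ⟨j, h | h⟩ := c.step i h1 h2
  · exact ⟨p, (j, true), hp, by rw [h, hp, uvec_eq, toPt_add]⟩
  · exact ⟨p, (j, false), hp, by rw [h, hp, sub_eq_add_neg, neg_uvec_eq, toPt_add]⟩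

/-- A step of a curve starting from the vertex `p`. -/
lemma exists_dir (c : Curve 3) {i : ℤ} {p : Z3} (h1 : i ∈ c.dom) (h2 : i + 1 ∈ c.dom)
    (hp : c.v i = toPt p) : ∃ u, c.v (i + 1) = toPt (p + dvec u) := by
  obtain ⟨q, u, hq, hu⟩ := c.exists_step h1 h2
  rw [hp, toPt_inj] at hq
  subst hq
  exact ⟨u, hu⟩

/-- A step of a curve arriving at the vertex `p`. -/
lemma exists_dir_pred (c : Curve 3) {i : ℤ} {p : Z3} (h1 : i - 1 ∈ c.dom) (h2 : i ∈ c.dom)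
    (hp : c.v i = toPt p) : ∃ u, c.v (i - 1) = toPt (p + dvec u) := by
  obtain ⟨q, u, hq, hu⟩ := c.exists_step h1 (by simpa using h2)
  rw [sub_add_cancel, hp, toPt_inj] at hu
  subst hu
  exact ⟨opp u, by rw [hq, dvec_opp, add_neg_cancel_right]⟩

lemma isSeg_of_mem (c : Curve 3) {S : Sym2 (Pt 3)} (h : S ∈ c.segs) : IsSeg S := by
  obtain ⟨i, h1, h2, rfl⟩ := h
  obtain ⟨p, u, hp, hu⟩ := c.exists_step h1 h2
  rw [hp, hu]
  exact isSeg_edge p u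

lemma conn_symm {n : ℕ} (c : Curve n) {S T : Sym2 (Pt n)} (h : c.conn S T) : c.conn T S := by
  obtain ⟨i, h1, h2, h⟩ := h
  exact ⟨i, h1, h2, h.symm⟩

lemma mem_of_conn {n : ℕ} (c : Curve n) {S T : Sym2 (Pt n)} (h : c.conn S T) : S ∈ c.segs := by
  obtain ⟨i, h1, h2, ⟨rfl, -⟩ | ⟨-, rfl⟩⟩ := h
  · exact ⟨i - 1, h1, by simpa using c.mem_dom_mid h1 h2, by simp⟩
  · exact ⟨i, c.mem_dom_mid h1 h2, h2, rfl⟩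

lemma conn_adj (c : Curve 3) {S T : Sym2 (Pt 3)} (h : c.conn S T) :
    ∃ p u v, u ≠ v ∧ S = edge p u ∧ T = edge p v := by
  obtain ⟨i, h1, h2, h⟩ := h
  have hi := c.mem_dom_mid h1 h2
  obtain ⟨p, hp⟩ := latt_iff.1 (c.lattice i hi)
  obtain ⟨u, hu⟩ := c.exists_dir_pred h1 hi hp
  obtain ⟨v, hv⟩ := c.exists_dir hi h2 hp
  have huv : u ≠ v := by
    rintro rfl
    exact c.noback i h1 h2 (hv.trans hu.symm)
  rw [hp, hu, hv] at h
  rcases h with ⟨rfl, rfl⟩ | ⟨rfl, rfl⟩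
  · exact ⟨p, u, v, huv, Sym2.eq_swap, rfl⟩
  · exact ⟨p, v, u, huv.symm, rfl, Sym2.eq_swap⟩

lemma conn_edge (c : Curve 3) {p : Z3} {u v : D6} (h : c.conn (edge p u) (edge p v)) :
    u ≠ v ∧ ∃ i, i - 1 ∈ c.dom ∧ i ∈ c.dom ∧ i + 1 ∈ c.dom ∧ c.v i = toPt p ∧
      ((c.v (i - 1) = toPt (p + dvec u) ∧ c.v (i + 1) = toPt (p + dvec v)) ∨
       (c.v (i - 1) = toPt (p + dvec v) ∧ c.v (i + 1) = toPt (p + dvec u))) := by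
  have huv : u ≠ v := by
    obtain ⟨q, a, b, hab, h1, h2⟩ := c.conn_adj h
    rintro rfl
    exact hab (edge_inj.1 (h1.symm.trans h2))
  refine ⟨huv, ?_⟩
  obtain ⟨i, h1, h2, h⟩ := h
  have hi := c.mem_dom_mid h1 h2
  obtain ⟨q, hq⟩ := latt_iff.1 (c.lattice i hi)
  obtain ⟨a, ha⟩ := c.exists_dir_pred h1 hi hq
  obtain ⟨b, hb⟩ := c.exists_dir hi h2 hq
  have e1 : s(c.v (i - 1), c.v i) = edge q a := by rw [hq, ha]; exact Sym2.eq_swap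
  have e2 : s(c.v i, c.v (i + 1)) = edge q b := by rw [hq, hb]; rfl
  rw [e1, e2] at h
  rcases h with ⟨h3, h4⟩ | ⟨h3, h4⟩
  · obtain ⟨rfl, rfl, rfl⟩ := edge_pair huv h3 h4
    exact ⟨i, h1, hi, h2, hq, Or.inl ⟨ha, hb⟩⟩
  · obtain ⟨rfl, rfl, rfl⟩ := edge_pair huv.symm h3 h4
    exact ⟨i, h1, hi, h2, hq, Or.inr ⟨ha, hb⟩⟩

/-- A self-avoiding curve meets the segment `edge p u` at its vertex `p` exactly once. -/
lemma index_unique {c : Curve 3} (hc : c.SelfAvoiding) {p : Z3} {u : D6} {i j : ℤ}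
    (hi : i ∈ c.dom) (hj : j ∈ c.dom) (hpi : c.v i = toPt p) (hpj : c.v j = toPt p)
    (hi' : (i - 1 ∈ c.dom ∧ c.v (i - 1) = toPt (p + dvec u)) ∨
      (i + 1 ∈ c.dom ∧ c.v (i + 1) = toPt (p + dvec u)))
    (hj' : (j - 1 ∈ c.dom ∧ c.v (j - 1) = toPt (p + dvec u)) ∨
      (j + 1 ∈ c.dom ∧ c.v (j + 1) = toPt (p + dvec u))) : i = j := by
  have key : ∀ {k : ℤ}, k ∈ c.dom → c.v k = toPt p →
      ((k - 1 ∈ c.dom ∧ c.v (k - 1) = toPt (p + dvec u)) ∨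
        (k + 1 ∈ c.dom ∧ c.v (k + 1) = toPt (p + dvec u))) →
      ∃ m, m ∈ c.dom ∧ m + 1 ∈ c.dom ∧ s(c.v m, c.v (m + 1)) = edge p u ∧
        (k = m ∨ k = m + 1) := by
    rintro k hk hpk (⟨h1, h2⟩ | ⟨h1, h2⟩)
    · refine ⟨k - 1, h1, by simpa using hk, ?_, by simp⟩
      rw [sub_add_cancel, hpk, h2]; exact Sym2.eq_swap
    · exact ⟨k, hk, h1, by rw [hpk, h2]; rfl, by simp⟩
  obtain ⟨m, m1, m2, m3, m4⟩ := key hi hpi hi'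
  obtain ⟨n, n1, n2, n3, n4⟩ := key hj hpj hj'
  have hmn : m = n := hc m n m1 m2 n1 n2 (m3.trans n3.symm)
  subst hmn
  have hne : c.v m ≠ c.v (m + 1) := by
    obtain ⟨q, a, hq, ha⟩ := c.exists_step m1 m2
    rw [hq, ha, Ne, toPt_inj, left_eq_add]
    exact dvec_ne_zero a
  rcases m4 with rfl | rfl <;> rcases n4 with rfl | rfl
  · rfl
  · exact absurd (hpi.trans hpj.symm) hne
  · exact absurd (hpj.trans hpi.symm) hne
  · rfl

lemma conn_unique {c : Curve 3} (hc : c.SelfAvoiding) {p : Z3} {u v w : D6}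
    (h1 : c.conn (edge p u) (edge p v)) (h2 : c.conn (edge p u) (edge p w)) : v = w := by
  obtain ⟨huv, i, i1, i2, i3, i4, i5⟩ := c.conn_edge h1
  obtain ⟨huw, j, j1, j2, j3, j4, j5⟩ := c.conn_edge h2
  have hij : i = j := by
    refine index_unique hc (u := u) i2 j2 i4 j4 ?_ ?_
    · exact i5.imp (fun h => ⟨i1, h.1⟩) (fun h => ⟨i3, h.2⟩)
    · exact j5.imp (fun h => ⟨j1, h.1⟩) (fun h => ⟨j3, h.2⟩)
  subst hij
  have inj : ∀ {a b : D6} {x : Pt 3}, x = toPt (p + dvec a) → x = toPt (p + dvec b) → a = b := by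
    rintro a b x h h'
    exact dvec_injective (add_left_cancel (toPt_inj.1 (h.symm.trans h')))
  rcases i5 with ⟨a1, a2⟩ | ⟨a1, a2⟩ <;> rcases j5 with ⟨b1, b2⟩ | ⟨b1, b2⟩
  · exact inj a2 b2
  · exact absurd (inj a1 b1) huw
  · exact absurd (inj b1 a1) huv
  · exact inj a1 b1

/-- A vertex of a segment of a curve is the vertex at some index. -/
lemma exists_index (c : Curve 3) {p : Z3} {u : D6} (h : edge p u ∈ c.segs) :
    ∃ i ∈ c.dom, c.v i = toPt p ∧ ((i - 1 ∈ c.dom ∧ c.v (i - 1) = toPt (p + dvec u)) ∨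
      (i + 1 ∈ c.dom ∧ c.v (i + 1) = toPt (p + dvec u))) := by
  obtain ⟨i, h1, h2, h⟩ := h
  unfold edge at h
  rcases Sym2.eq_iff.1 h with ⟨h3, h4⟩ | ⟨h3, h4⟩
  · exact ⟨i, h1, h3.symm, Or.inr ⟨h2, h4.symm⟩⟩
  · exact ⟨i + 1, h2, h3.symm, Or.inl ⟨by simpa using h1, by simpa using h4.symm⟩⟩

/-- A segment of a curve either is connected at `p`, or `p` is an endpoint. -/
lemma conn_or_endpt (c : Curve 3) {p : Z3} {u : D6} (h : edge p u ∈ c.segs) :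
    (∃ v, c.conn (edge p u) (edge p v)) ∨ c.IsEndpt (toPt p) := by
  obtain ⟨i, hi, hp, h⟩ := c.exists_index h
  by_cases h1 : i - 1 ∈ c.dom
  · by_cases h2 : i + 1 ∈ c.dom
    · left
      rcases h with ⟨-, h⟩ | ⟨-, h⟩
      · obtain ⟨v, hv⟩ := c.exists_dir hi h2 hp
        exact ⟨v, i, h1, h2, Or.inl ⟨by rw [h, hp]; exact Sym2.eq_swap, by rw [hp, hv]; rfl⟩⟩
      · obtain ⟨v, hv⟩ := c.exists_dir_pred h1 hi hp
        exact ⟨v, i, h1, h2, Or.inr ⟨by rw [hv, hp]; exact Sym2.eq_swap, by rw [hp, h]; rfl⟩⟩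
    · exact Or.inr ⟨i, hi, hp.symm, Or.inr h2⟩
  · exact Or.inr ⟨i, hi, hp.symm, Or.inl h1⟩

lemma exists_endSegAt (c : Curve 3) {x : Pt 3} (h : c.IsEndpt x) : ∃ S, c.endSegAt x S := by
  obtain ⟨i, hi, rfl, h⟩ := h
  obtain ⟨k, k1, k2⟩ := c.nontriv
  rcases h with h | h
  · refine ⟨s(c.v i, c.v (i + 1)), i, hi, rfl, Or.inl ⟨h, ?_, rfl⟩⟩
    by_cases hki : i ≤ k
    · exact c.ordConn.out hi k2 ⟨by omega, by omega⟩
    · exact absurd (c.ordConn.out k1 hi ⟨by omega, by omega⟩) h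
  · refine ⟨s(c.v (i - 1), c.v i), i, hi, rfl, Or.inr ⟨h, ?_, rfl⟩⟩
    by_cases hki : i ≤ k
    · exact absurd (c.ordConn.out hi k2 ⟨by omega, by omega⟩) h
    · exact c.ordConn.out k1 hi ⟨by omega, by omega⟩

lemma endSegAt_edge (c : Curve 3) {p : Z3} {S : Sym2 (Pt 3)} (h : c.endSegAt (toPt p) S) :
    ∃ u, S = edge p u ∧ S ∈ c.segs := by
  obtain ⟨i, hi, hp, ⟨h1, h2, rfl⟩ | ⟨h1, h2, rfl⟩⟩ := h
  · obtain ⟨u, hu⟩ := c.exists_dir hi h2 hp.symm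
    exact ⟨u, by rw [hu, ← hp]; rfl, i, hi, h2, rfl⟩
  · obtain ⟨u, hu⟩ := c.exists_dir_pred h2 hi hp.symm
    exact ⟨u, by rw [hu, ← hp]; exact Sym2.eq_swap, i - 1, h2, by simpa using hi, by simp⟩

lemma endSegAt_not_conn {c : Curve 3} (hc : c.SelfAvoiding) {p : Z3} {u v : D6}
    (h : c.endSegAt (toPt p) (edge p u)) : ¬ c.conn (edge p u) (edge p v) := by
  intro h'
  obtain ⟨-, j, j1, j2, j3, j4, j5⟩ := c.conn_edge h'
  obtain ⟨i, hi, hp, h⟩ := h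
  have key : i = j := by
    refine index_unique hc (u := u) hi j2 hp.symm j4 ?_
      (j5.imp (fun h => ⟨j1, h.1⟩) (fun h => ⟨j3, h.2⟩))
    rw [← hp] at *
    unfold edge at h
    rw [← hp] at h
    rcases h with ⟨-, h2, h3⟩ | ⟨-, h2, h3⟩
    · exact Or.inr ⟨h2, (Sym2.congr_right.1 h3).symm⟩
    · rw [Sym2.eq_swap] at h3
      exact Or.inl ⟨h2, (Sym2.congr_left.1 h3).symm⟩
  subst key
  rcases h with ⟨h, -⟩ | ⟨h, -⟩
  · exact h j1
  · exact h j3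

/-- Endpoints of a self-avoiding curve are read off from its segments and connexions. -/
lemma isEndpt_iff {c : Curve 3} (hc : c.SelfAvoiding) {p : Z3} :
    c.IsEndpt (toPt p) ↔
      ∃ u, edge p u ∈ c.segs ∧ ∀ v, ¬ c.conn (edge p u) (edge p v) := by
  constructor
  · intro h
    obtain ⟨S, hS⟩ := c.exists_endSegAt h
    obtain ⟨u, rfl, hu⟩ := c.endSegAt_edge hS
    exact ⟨u, hu, fun v => endSegAt_not_conn hc hS⟩
  · rintro ⟨u, hu, h⟩
    rcases c.conn_or_endpt hu with ⟨v, hv⟩ | h'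
    · exact absurd hv (h v)
    · exact h'

/-- A set of segments of a curve stable under connexions is everything. -/
lemma segs_induction {n : ℕ} (c : Curve n) {A : Sym2 (Pt n) → Prop} {S : Sym2 (Pt n)}
    (hS : S ∈ c.segs) (h0 : A S) (hA : ∀ T T', c.conn T T' → A T → A T') :
    ∀ T ∈ c.segs, A T := by
  obtain ⟨i, i1, i2, rfl⟩ := hS
  have up : ∀ k : ℕ, i + k + 1 ∈ c.dom → A s(c.v (i + k), c.v (i + k + 1)) := by
    intro k
    induction k with
    | zero => intro _; simpa using h0
    | succ k ih =>
      intro hk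
      push_cast at hk ⊢
      have h1 : i + k ∈ c.dom := c.ordConn.out i1 hk ⟨by omega, by omega⟩
      have h2 : i + k + 1 ∈ c.dom := c.ordConn.out i1 hk ⟨by omega, by omega⟩
      refine hA _ _ ⟨i + k + 1, by simpa using h1, by simpa [add_assoc] using hk, Or.inl ⟨?_, ?_⟩⟩
        (ih h2)
      · simp
      · simp [add_assoc]
  have down : ∀ k : ℕ, i - k ∈ c.dom → A s(c.v (i - k), c.v (i - k + 1)) := by
    intro k
    induction k with
    | zero => intro _; simpa using h0
    | succ k ih =>
      intro hk
      push_cast at hk ⊢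
      have h1 : i - k ∈ c.dom := c.ordConn.out hk i1 ⟨by omega, by omega⟩
      have h2 : i - k + 1 ∈ c.dom := c.ordConn.out hk i2 ⟨by omega, by omega⟩
      have e1 : i - k - 1 = i - (k + 1 : ℤ) := by ring
      have e2 : i - (k + 1 : ℤ) + 1 = i - k := by ring
      refine hA _ _ ⟨i - k, by rw [e1]; exact hk, h2, Or.inr ⟨?_, rfl⟩⟩ (ih h1)
      rw [e2, e1]
  rintro T ⟨j, j1, j2, rfl⟩
  rcases le_total i j with hij | hij
  · obtain ⟨k, hk⟩ := Int.eq_ofNat_of_zero_le (sub_nonneg.2 hij)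
    obtain rfl : j = i + k := by omega
    exact up k j2
  · obtain ⟨k, hk⟩ := Int.eq_ofNat_of_zero_le (sub_nonneg.2 hij)
    obtain rfl : j = i - k := by omega
    exact down k j1

end Curve

section Covering

variable {C3 : Set (Curve 3)}

lemma SameCurve.endpt {c d : Curve 3} (h : SameCurve c d) (hc : c.SelfAvoiding)
    (hd : d.SelfAvoiding) {p : Z3} (hp : c.IsEndpt (toPt p)) : d.IsEndpt (toPt p) := by
  rw [Curve.isEndpt_iff hc, h.1, h.2] at hp
  exact (Curve.isEndpt_iff hd).2 hp

lemma DisjSA.same {E : Set (Curve 3)} (hE : DisjSA E) {c d : Curve 3} (hc : c ∈ E) (hd : d ∈ E)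
    {S : Sym2 (Pt 3)} (h1 : S ∈ c.segs) (h2 : S ∈ d.segs) : SameCurve c d := by
  by_contra h
  exact hE.2 c hc d hd h S h1 h2

lemma traceOf_conn_symm {E : Set (Curve 3)} {S T : Sym2 (Pt 3)} (h : (traceOf E).conn S T) :
    (traceOf E).conn T S := by
  obtain ⟨c, hc, h⟩ := h
  exact ⟨c, hc, c.conn_symm h⟩

lemma traceOf_conn_adj {E : Set (Curve 3)} {S T : Sym2 (Pt 3)} (h : (traceOf E).conn S T) :
    ∃ p u v, u ≠ v ∧ S = edge p u ∧ T = edge p v := by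
  obtain ⟨c, hc, h⟩ := h
  exact c.conn_adj h

lemma traceOf_conn_ne {E : Set (Curve 3)} {p : Z3} {u v : D6}
    (h : (traceOf E).conn (edge p u) (edge p v)) : u ≠ v := by
  obtain ⟨c, hc, h⟩ := h
  exact (c.conn_edge h).1

lemma DisjSA.conn_unique {E : Set (Curve 3)} (hE : DisjSA E) {p : Z3} {u v w : D6}
    (h1 : (traceOf E).conn (edge p u) (edge p v)) (h2 : (traceOf E).conn (edge p u) (edge p w)) :
    v = w := by
  obtain ⟨c, hc, h1⟩ := h1
  obtain ⟨d, hd, h2⟩ := h2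
  have := hE.same hc hd (c.mem_of_conn h1) (d.mem_of_conn h2)
  rw [← this.2] at h2
  exact Curve.conn_unique (hE.1 c hc) h1 h2

lemma Covers.segs_eq {E : Set (Curve 3)} (hE : Covers E univ) :
    (traceOf E).segs = {S | IsSeg S} := by
  ext S
  constructor
  · rintro ⟨c, -, h⟩; exact c.isSeg_of_mem h
  · intro h
    refine (hE S h ?_).1
    obtain ⟨p, u, rfl⟩ := isSeg_iff.1 h
    exact ⟨toPt p, ⟨_, _, rfl, 0, le_rfl, zero_le_one, by simp⟩, mem_univ _⟩

lemma toPt_mulOf {m : ℕ} {x : Pt 3} (hx : inLat m x) : ∃ p, x = toPt p ∧ MulOf m p := by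
  obtain ⟨p, rfl⟩ := latt_iff.1 (inLat_latt hx)
  exact ⟨p, rfl, inLat_toPt.1 hx⟩

lemma toPt_add_uvec (p : Z3) (i : Fin 3) :
    toPt p + ((2 : ℕ) : ℝ) • uvec 3 i = toPt (p + 2 • dvec (i, true)) := by
  rw [toPt_add, toPt_two_smul, uvec_eq]; norm_num

namespace SatH

variable (hH : SatH C3 2 4)
include hH

lemma sa {c : Curve 3} (hc : c ∈ C3) : c.SelfAvoiding := hH.2.2.2.1.1.1 c hc

lemma disjSA : DisjSA C3 := hH.2.2.2.1.1

lemma segs_eq : (traceOf C3).segs = {S | IsSeg S} := Covers.segs_eq hH.2.2.2.1.2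

lemma edge_mem (p : Z3) (u : D6) : ∃ c ∈ C3, edge p u ∈ c.segs := by
  have : edge p u ∈ (traceOf C3).segs := by rw [hH.segs_eq]; exact isSeg_edge p u
  exact this

/-- The two endpoints of a curve. -/
lemma endpts {c : Curve 3} (hc : c ∈ C3) : ∃ p u, MulOf 2 p ∧ c.IsEndpt (toPt p) ∧
    c.IsEndpt (toPt (p + 2 • dvec u)) ∧
    ∀ q, c.IsEndpt (toPt q) → q = p ∨ q = p + 2 • dvec u := by
  obtain ⟨-, x, i, -, hx, h1, h2, h3⟩ := hH.2.2.2.2.1 c hc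
  obtain ⟨p, rfl, hp⟩ := toPt_mulOf hx
  rw [toPt_add_uvec] at h2 h3
  exact ⟨p, (i, true), hp, h1, h2, fun q hq => (h3 _ hq).imp toPt_inj.1 toPt_inj.1⟩

lemma even_of_endpt {c : Curve 3} (hc : c ∈ C3) {q : Z3} (h : c.IsEndpt (toPt q)) :
    MulOf 2 q := by
  obtain ⟨p, u, hp, -, -, h'⟩ := hH.endpts hc
  rcases h' q h with rfl | rfl
  · exact hp
  · exact hp.add (mulOf_two_smul _)

lemma curve_true {p : Z3} (hp : MulOf 2 p) (i : Fin 3) :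
    (∃ c ∈ C3, c.IsEndpt (toPt p) ∧ c.IsEndpt (toPt (p + 2 • dvec (i, true)))) ∧
    ∀ c ∈ C3, ∀ d ∈ C3, c.IsEndpt (toPt p) → c.IsEndpt (toPt (p + 2 • dvec (i, true))) →
      d.IsEndpt (toPt p) → d.IsEndpt (toPt (p + 2 • dvec (i, true))) → SameCurve c d := by
  have := hH.2.2.2.2.2.1 (toPt p) i (latt_toPt p) (inLat_toPt.2 hp)
  rwa [toPt_add_uvec] at this

lemma curve_dir {p : Z3} (hp : MulOf 2 p) (u : D6) :
    (∃ c ∈ C3, c.IsEndpt (toPt p) ∧ c.IsEndpt (toPt (p + 2 • dvec u))) ∧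
    ∀ c ∈ C3, ∀ d ∈ C3, c.IsEndpt (toPt p) → c.IsEndpt (toPt (p + 2 • dvec u)) →
      d.IsEndpt (toPt p) → d.IsEndpt (toPt (p + 2 • dvec u)) → SameCurve c d := by
  obtain ⟨i, b⟩ := u
  cases b
  · have h := hH.curve_true (hp.add (mulOf_two_smul (dvec (i, false)))) i
    have e : p + 2 • dvec (i, false) + 2 • dvec (i, true) = p := by
      rw [show dvec (i, true) = -dvec (i, false) from (neg_dvec i false).symm]
      simp
    rw [e] at h
    obtain ⟨⟨c, hc, h1, h2⟩, h3⟩ := h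
    exact ⟨⟨c, hc, h2, h1⟩, fun c hc d hd a1 a2 b1 b2 => h3 c hc d hd a2 a1 b2 b1⟩
  · exact hH.curve_true hp i

/-- A curve with endpoints `p`, `p + 2u`, `p + 2v` has `u = v`. -/
lemma dir_unique {c : Curve 3} (hc : c ∈ C3) {p : Z3} {u v : D6} (h : c.IsEndpt (toPt p))
    (hu : c.IsEndpt (toPt (p + 2 • dvec u))) (hv : c.IsEndpt (toPt (p + 2 • dvec v))) :
    u = v := by
  obtain ⟨q, w, -, -, -, h'⟩ := hH.endpts hc
  have inj : ∀ a b : D6, p + 2 • dvec a = p + 2 • dvec b → a = b := by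
    intro a b h
    have := add_left_cancel h
    refine dvec_injective (funext fun i => ?_)
    have := congrFun this i
    simpa using this
  have ne : ∀ a : D6, p ≠ p + 2 • dvec a := by
    intro a h
    refine dvec_ne_zero a (funext fun i => ?_)
    have := congrFun (left_eq_add.1 h) i
    simpa using this
  have n1 := ne u
  have n2 := ne v
  apply inj
  rcases h' _ h with h1 | h1 <;> rcases h' _ hu with h2 | h2 <;> rcases h' _ hv with h3 | h3
  all_goals first
    | exact h2.trans h3.symm
    | exact absurd (h1.trans h2.symm) n1
    | exact absurd (h1.trans h3.symm) n2

/-- The first direction of the curve issued from `p` and ending at `p + 2u`, as a permutation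
of the six directions. -/
lemma exists_perm {p : Z3} (hp : MulOf 2 p) : ∃ w : D6 → D6, Function.Bijective w ∧
    ∀ u, ∃ c ∈ C3, c.IsEndpt (toPt p) ∧ c.IsEndpt (toPt (p + 2 • dvec u)) ∧
      c.endSegAt (toPt p) (edge p (w u)) := by
  have : ∀ u, ∃ a, ∃ c ∈ C3, c.IsEndpt (toPt p) ∧ c.IsEndpt (toPt (p + 2 • dvec u)) ∧
      c.endSegAt (toPt p) (edge p a) := by
    intro u
    obtain ⟨⟨c, hc, h1, h2⟩, -⟩ := hH.curve_dir hp u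
    obtain ⟨S, hS⟩ := c.exists_endSegAt h1
    obtain ⟨a, rfl, -⟩ := c.endSegAt_edge hS
    exact ⟨a, c, hc, h1, h2, hS⟩
  choose w hw using this
  refine ⟨w, Finite.injective_iff_bijective.1 fun u v huv => ?_, hw⟩
  obtain ⟨c, hc, c1, c2, c3⟩ := hw u
  obtain ⟨d, hd, d1, d2, d3⟩ := hw v
  rw [← huv] at d3
  obtain ⟨-, -, c4⟩ := c.endSegAt_edge c3
  obtain ⟨-, -, d4⟩ := d.endSegAt_edge d3
  have hs := hH.disjSA.same hd hc d4 c4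
  exact hH.dir_unique hc c1 c2 (hs.endpt (hH.sa hd) (hH.sa hc) d2)

lemma not_conn_even {p : Z3} (hp : MulOf 2 p) (u v : D6) :
    ¬ (traceOf C3).conn (edge p u) (edge p v) := by
  obtain ⟨w, hw, h⟩ := hH.exists_perm hp
  obtain ⟨a, rfl⟩ := hw.2 u
  obtain ⟨c, hc, -, -, c3⟩ := h a
  rintro ⟨d, hd, hconn⟩
  obtain ⟨-, -, c4⟩ := c.endSegAt_edge c3
  have hs := hH.disjSA.same hd hc (d.mem_of_conn hconn) c4
  rw [hs.2] at hconn
  exact Curve.endSegAt_not_conn (hH.sa hc) c3 hconn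

lemma conn_odd {p : Z3} (hp : ¬ MulOf 2 p) (u : D6) :
    ∃ v, (traceOf C3).conn (edge p u) (edge p v) := by
  obtain ⟨c, hc, h⟩ := hH.edge_mem p u
  rcases c.conn_or_endpt h with ⟨v, hv⟩ | h'
  · exact ⟨v, c, hc, hv⟩
  · exact absurd (hH.even_of_endpt hc h') hp

lemma endpt_of_mem {c : Curve 3} (hc : c ∈ C3) {p : Z3} (hp : MulOf 2 p) {u : D6}
    (h : edge p u ∈ c.segs) : c.IsEndpt (toPt p) := by
  rcases c.conn_or_endpt h with ⟨v, hv⟩ | h'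
  · exact absurd ⟨c, hc, hv⟩ (hH.not_conn_even hp u v)
  · exact h'

lemma mem_unique {c : Curve 3} (hc : c ∈ C3) {p : Z3} (hp : MulOf 2 p) {u v : D6}
    (hu : edge p u ∈ c.segs) (hv : edge p v ∈ c.segs) : u = v := by
  obtain ⟨w, hw, h⟩ := hH.exists_perm hp
  have key : ∀ a, edge p (w a) ∈ c.segs → c.IsEndpt (toPt (p + 2 • dvec a)) := by
    intro a ha
    obtain ⟨d, hd, d1, d2, d3⟩ := h a
    obtain ⟨-, -, d4⟩ := d.endSegAt_edge d3
    exact (hH.disjSA.same hd hc d4 ha).endpt (hH.sa hd) (hH.sa hc) d2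
  obtain ⟨a, rfl⟩ := hw.2 u
  obtain ⟨b, rfl⟩ := hw.2 v
  rw [hH.dir_unique hc (hH.endpt_of_mem hc hp hu) (key a hu) (key b hv)]

lemma endSegAt_iff {c : Curve 3} (hc : c ∈ C3) {p : Z3} (hp : MulOf 2 p) {S : Sym2 (Pt 3)} :
    c.endSegAt (toPt p) S ↔ ∃ u, S = edge p u ∧ edge p u ∈ c.segs := by
  constructor
  · intro h
    obtain ⟨u, rfl, h⟩ := c.endSegAt_edge h
    exact ⟨u, rfl, h⟩
  · rintro ⟨u, rfl, hu⟩
    obtain ⟨S, hS⟩ := c.exists_endSegAt (hH.endpt_of_mem hc hp hu)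
    obtain ⟨v, rfl, hv⟩ := c.endSegAt_edge hS
    rwa [hH.mem_unique hc hp hu hv]

/-- The trace of `C3` is invariant under `4ℤ³`. -/
lemma conn_add {t : Z3} (ht : MulOf 4 t) {S T : Sym2 (Pt 3)} (h : (traceOf C3).conn S T) :
    (traceOf C3).conn (Sym2.map (fun x => x + toPt t) S) (Sym2.map (fun x => x + toPt t) T) := by
  rw [← hH.2.2.2.2.2.2 (toPt t) (inLat_toPt.2 ht)]
  exact ⟨S, T, h, rfl, rfl⟩

lemma curve_add {t : Z3} (ht : MulOf 4 t) {c : Curve 3} (hc : c ∈ C3) :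
    ∃ d ∈ C3, ∀ p u, edge p u ∈ c.segs → edge (p + t) u ∈ d.segs := by
  obtain ⟨i, i1, i2⟩ := c.nontriv
  have h0 : s(c.v i, c.v (i + 1)) ∈ c.segs := ⟨i, i1, i2, rfl⟩
  obtain ⟨p, u, hpu⟩ := isSeg_iff.1 (c.isSeg_of_mem h0)
  obtain ⟨d, hd, hd'⟩ := hH.edge_mem (p + t) u
  refine ⟨d, hd, fun q v hqv => ?_⟩
  rw [← map_add_edge]
  refine c.segs_induction (A := fun S => Sym2.map (fun x => x + toPt t) S ∈ d.segs) h0 ?_ ?_ _ hqv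
  · rw [hpu, map_add_edge]; exact hd'
  · intro S T hST hS
    obtain ⟨d', h1, h2⟩ := hH.conn_add ht ⟨c, hc, hST⟩
    rw [(hH.disjSA.same hd h1 hS (d'.mem_of_conn h2)).1]
    exact d'.mem_of_conn (d'.conn_symm h2)

/-- `firstDir p u` is the direction in which the curve from `p` to `p + 2u` leaves `p`. -/
lemma exists_firstDir : ∃ w : Z3 → D6 → D6, ∀ p, MulOf 2 p → Function.Bijective (w p) ∧
    (∀ u, ∀ c ∈ C3, c.IsEndpt (toPt p) → c.IsEndpt (toPt (p + 2 • dvec u)) →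
      ∀ S, c.endSegAt (toPt p) S ↔ S = edge p (w p u)) ∧
    (∀ c ∈ C3, ∀ u a, edge p a ∈ c.segs → c.IsEndpt (toPt (p + 2 • dvec u)) → a = w p u) := by
  have : ∀ p, ∃ w : D6 → D6, MulOf 2 p → Function.Bijective w ∧
      (∀ u, ∀ c ∈ C3, c.IsEndpt (toPt p) → c.IsEndpt (toPt (p + 2 • dvec u)) →
        ∀ S, c.endSegAt (toPt p) S ↔ S = edge p (w u)) ∧
      (∀ c ∈ C3, ∀ u a, edge p a ∈ c.segs → c.IsEndpt (toPt (p + 2 • dvec u)) → a = w u) := by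
    intro p
    by_cases hp : MulOf 2 p
    · obtain ⟨w, hw, h⟩ := hH.exists_perm hp
      have mem : ∀ c ∈ C3, ∀ u, c.IsEndpt (toPt p) → c.IsEndpt (toPt (p + 2 • dvec u)) →
          edge p (w u) ∈ c.segs := by
        intro c hc u h1 h2
        obtain ⟨d, hd, d1, d2, d3⟩ := h u
        rw [((hH.curve_dir hp u).2 c hc d hd h1 h2 d1 d2).1]
        exact (d.endSegAt_edge d3).choose_spec.2
      refine ⟨w, fun _ => ⟨hw, fun u c hc h1 h2 S => ?_, fun c hc u a ha h2 => ?_⟩⟩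
      · rw [hH.endSegAt_iff hc hp]
        constructor
        · rintro ⟨a, rfl, ha⟩
          rw [hH.mem_unique hc hp ha (mem c hc u h1 h2)]
        · rintro rfl
          exact ⟨_, rfl, mem c hc u h1 h2⟩
      · exact hH.mem_unique hc hp ha (mem c hc u (hH.endpt_of_mem hc hp ha) h2)
    · exact ⟨id, fun h => absurd h hp⟩
  choose w hw using this
  exact ⟨w, hw⟩

end SatH

end Covering

/-- The permutation `θ` on direction labels. -/
def thetaD : D6 → D6
  | (0, true) => (1, false)
  | (1, false) => (0, true)
  | (1, true) => (2, false)
  | (2, false) => (1, true)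
  | (2, true) => (0, false)
  | (0, false) => (2, true)

lemma thetaD_thetaD (u : D6) : thetaD (thetaD u) = u := by
  revert u; decide

lemma theta3_toPt (u : D6) : theta3 (toPt (dvec u)) = toPt (dvec (thetaD u)) := by
  obtain ⟨i, b⟩ := u
  unfold theta3
  simp only [neg_uvec_eq]
  simp only [uvec_eq, toPt_inj, dvec_inj]
  fin_cases i <;> cases b <;> simp [thetaD]

lemma theta3_of_not_isDir {u : Pt 3} (h : ¬ IsDir u) : theta3 u = u := by
  have h1 : ∀ i, u ≠ uvec 3 i := fun i hi => h ⟨i, Or.inl hi⟩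
  have h2 : ∀ i, u ≠ -uvec 3 i := fun i hi => h ⟨i, Or.inr hi⟩
  simp [theta3, h1, h2]

lemma p3_eq (a b c : ℤ) : p3 a b c = toPt ![a, b, c] := by
  ext i; fin_cases i <;> simp [p3, toPt3]

lemma exists_list (u : D6) : ∃ M ∈ B0, M.length = 9 ∧ M.getD 0 0 = toPt 0 ∧
    M.getD 1 0 = toPt (0 + dvec (thetaD u)) ∧
    M.getD 7 0 = toPt (0 + 2 • dvec u + dvec (opp u)) ∧
    M.getD 8 0 = toPt (0 + 2 • dvec u) := by
  have key : ∀ (k : ℕ) (hk : k < B0.length), (B0[k]).length = 9 →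
      (B0[k]).getD 0 0 = toPt 0 →
      (B0[k]).getD 1 0 = toPt (0 + dvec (thetaD u)) →
      (B0[k]).getD 7 0 = toPt (0 + 2 • dvec u + dvec (opp u)) →
      (B0[k]).getD 8 0 = toPt (0 + 2 • dvec u) →
      ∃ M ∈ B0, M.length = 9 ∧ M.getD 0 0 = toPt 0 ∧
        M.getD 1 0 = toPt (0 + dvec (thetaD u)) ∧
        M.getD 7 0 = toPt (0 + 2 • dvec u + dvec (opp u)) ∧
        M.getD 8 0 = toPt (0 + 2 • dvec u) :=
    fun k hk h1 h2 h3 h4 h5 => ⟨B0[k], List.getElem_mem hk, h1, h2, h3, h4, h5⟩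
  obtain ⟨i, b⟩ := u
  fin_cases i <;> cases b
  · refine key 1 (by simp [B0]) rfl ?_ ?_ ?_ ?_ <;>
      simp only [B0, List.getElem_cons_succ, List.getElem_cons_zero, List.getD_cons_zero,
        List.getD_cons_succ, p3_eq, toPt_inj] <;> decide
  · refine key 0 (by simp [B0]) rfl ?_ ?_ ?_ ?_ <;>
      simp only [B0, CList, List.getElem_cons_zero, List.getD_cons_zero,
        List.getD_cons_succ, p3_eq, toPt_inj] <;> decide
  · refine key 3 (by simp [B0]) rfl ?_ ?_ ?_ ?_ <;>
      simp only [B0, List.getElem_cons_succ, List.getElem_cons_zero, List.getD_cons_zero,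
        List.getD_cons_succ, p3_eq, toPt_inj] <;> decide
  · refine key 2 (by simp [B0]) rfl ?_ ?_ ?_ ?_ <;>
      simp only [B0, List.getElem_cons_succ, List.getElem_cons_zero, List.getD_cons_zero,
        List.getD_cons_succ, p3_eq, toPt_inj] <;> decide
  · refine key 5 (by simp [B0]) rfl ?_ ?_ ?_ ?_ <;>
      simp only [B0, List.getElem_cons_succ, List.getElem_cons_zero, List.getD_cons_zero,
        List.getD_cons_succ, p3_eq, toPt_inj] <;> decide
  · refine key 4 (by simp [B0]) rfl ?_ ?_ ?_ ?_ <;>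
      simp only [B0, List.getElem_cons_succ, List.getElem_cons_zero, List.getD_cons_zero,
        List.getD_cons_succ, p3_eq, toPt_inj] <;> decide

lemma transl_zero_segs {T : Trace 3} {S : Sym2 (Pt 3)} (h : S ∈ T.segs) :
    S ∈ (Trace.transl ((4 : ℝ) • (0 : Pt 3)) T).segs :=
  ⟨S, h, by simp⟩

lemma transl_zero_conn {T : Trace 3} {S S' : Sym2 (Pt 3)} (h : T.conn S S') :
    (Trace.transl ((4 : ℝ) • (0 : Pt 3)) T).conn S S' :=
  ⟨S, S', h, by simp, by simp⟩

lemma latt_zero : latt (0 : Pt 3) := fun _ => ⟨0, by simp⟩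

/-- The successive segments of a list of `ℬ₀` belong to a single curve. -/
lemma exists_curve_of_list {C3 : Set (Curve 3)} (hC3 : traceOf C3 = CTrace) (hH : SatH C3 2 4)
    {M : List (Pt 3)} (hM : M ∈ B0) (hl : 1 < M.length) :
    ∃ c ∈ C3, ∀ j, j + 1 < M.length → s(M.getD j 0, M.getD (j + 1) 0) ∈ c.segs := by
  have h0 : s(M.getD 0 0, M.getD 1 0) ∈ (traceOf C3).segs := by
    rw [hC3]
    exact ⟨0, latt_zero, 0, M, hM, transl_zero_segs ⟨0, hl, rfl⟩⟩
  obtain ⟨c, hc, h0⟩ := h0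
  refine ⟨c, hc, fun j => ?_⟩
  induction j with
  | zero => exact fun _ => h0
  | succ j ih =>
    intro hj
    have hconn : (traceOf C3).conn s(M.getD j 0, M.getD (j + 1) 0)
        s(M.getD (j + 1) 0, M.getD (j + 1 + 1) 0) := by
      rw [hC3]
      exact ⟨0, latt_zero, 0, M, hM, transl_zero_conn ⟨j, hj, Or.inl ⟨rfl, rfl⟩⟩⟩
    obtain ⟨d, hd, h⟩ := hconn
    rw [(hH.disjSA.same hc hd (ih (by omega)) (d.mem_of_conn h)).1]
    exact d.mem_of_conn (d.conn_symm h)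

/-- The first directions of the curves of the covering are `4ℤ³`-periodic, and equal to `θ`
on `4ℤ³`. -/
lemma exists_firstDir_theta {C3 : Set (Curve 3)} (hC3 : traceOf C3 = CTrace)
    (hH : SatH C3 2 4) : ∃ w : Z3 → D6 → D6,
    (∀ p, MulOf 2 p → Function.Bijective (w p)) ∧
    (∀ p, MulOf 2 p → ∀ u, ∀ c ∈ C3, c.IsEndpt (toPt p) → c.IsEndpt (toPt (p + 2 • dvec u)) →
      ∀ S, c.endSegAt (toPt p) S ↔ S = edge p (w p u)) ∧
    (∀ p t, MulOf 2 p → MulOf 4 t → w (p + t) = w p) ∧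
    (∀ p, MulOf 4 p → w p = thetaD) := by
  obtain ⟨w, hw⟩ := hH.exists_firstDir
  have per : ∀ p t, MulOf 2 p → MulOf 4 t → w (p + t) = w p := by
    intro p t hp ht
    have hpt : MulOf 2 (p + t) := hp.add (ht.trans (by norm_num))
    funext u
    obtain ⟨⟨c, hc, h1, h2⟩, -⟩ := hH.curve_dir hp u
    obtain ⟨S, hS⟩ := c.exists_endSegAt h1
    obtain ⟨a, rfl, ha⟩ := c.endSegAt_edge hS
    obtain ⟨S', hS'⟩ := c.exists_endSegAt h2
    obtain ⟨b, rfl, hb⟩ := c.endSegAt_edge hS'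
    obtain ⟨d, hd, hcd⟩ := hH.curve_add ht hc
    have hd2 : d.IsEndpt (toPt (p + t + 2 • dvec u)) :=
      hH.endpt_of_mem hd (hpt.add (mulOf_two_smul _)) (u := b)
        (by rw [add_right_comm]; exact hcd _ _ hb)
    rw [← (hw p hp).2.2 c hc u a ha h2, ← (hw (p + t) hpt).2.2 d hd u a (hcd _ _ ha) hd2]
  refine ⟨w, fun p hp => (hw p hp).1, fun p hp => (hw p hp).2.1, per, fun p hp => ?_⟩
  have h0 : MulOf 2 (0 : Z3) := fun i => dvd_zero _
  rw [show p = 0 + p by simp, per 0 p h0 hp]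
  funext u
  obtain ⟨M, hM, hl, m0, m1, m7, m8⟩ := exists_list u
  obtain ⟨c, hc, h⟩ := exists_curve_of_list hC3 hH hM (by omega)
  have hfirst := h 0 (by omega)
  have hlast := h 7 (by omega)
  rw [m0, m1] at hfirst
  rw [m7, m8, Sym2.eq_swap] at hlast
  exact ((hw 0 h0).2.2 c hc u _ hfirst
    (hH.endpt_of_mem hc (h0.add (mulOf_two_smul _)) hlast)).symm

/-- The connexions of a trace at the vertex `p`. -/
def Trace.rel (T : Trace 3) (p : Z3) (u v : D6) : Prop := T.conn (edge p u) (edge p v)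

/-- The properties of the connexions of the powers `𝒞^s` used below. -/
structure Tower (Q : ℕ → Z3 → D6 → D6 → Prop) : Prop where
  per : ∀ s p z, MulOf (2 ^ (s + 1)) z → Q s (p + z) = Q s p
  full : ∀ s p, ¬ MulOf (2 ^ s) p → ∀ u, ∃ v, Q s p u v
  none : ∀ s p, MulOf (2 ^ s) p → ∀ u v, ¬ Q s p u v
  mono : ∀ s p u v, Q s p u v → Q (s + 1) p u v
  func : ∀ s p u v w, Q s p u v → Q s p u w → v = w
  symm : ∀ s p u v, Q s p u v → Q s p v u
  irrefl : ∀ s p u, ¬ Q s p u u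
  theta : ∀ s q u v, MulOf 2 q → (Q (s + 1) (2 • q) (thetaD u) (thetaD v) ↔ Q s q u v)

section Powers

variable {C3 : Set (Curve 3)} {P : ℕ → Set (Curve 3)}

/-- Two connected segments with common endpoint `b`. -/
lemma conn_common {E : Set (Curve 3)} {a b d : Pt 3} (h : (traceOf E).conn s(a, b) s(b, d)) :
    ∃ r x y, b = toPt r ∧ a = toPt (r + dvec x) ∧ d = toPt (r + dvec y) ∧
      (traceOf E).rel r x y := by
  obtain ⟨r, x, y, hxy, h1, h2⟩ := traceOf_conn_adj h
  have hb1 : b ∈ edge r x := h1 ▸ Sym2.mem_mk_right a b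
  have hb2 : b ∈ edge r y := h2 ▸ Sym2.mem_mk_left b d
  have hb : b = toPt r := by
    rw [mem_edge] at hb1 hb2
    rcases hb1 with hb1 | hb1
    · exact hb1
    · rcases hb2 with hb2 | hb2
      · exact hb2
      · exact absurd (dvec_injective (add_left_cancel (toPt_inj.1 (hb1.symm.trans hb2)))) hxy
  rw [h1, h2] at h
  subst hb
  refine ⟨r, x, y, rfl, ?_, ?_, h⟩
  · rw [Sym2.eq_swap] at h1
    exact Sym2.congr_right.1 h1
  · exact Sym2.congr_right.1 h2

lemma exists_toPt_edge_endpts (hH : SatH C3 2 4) {c : Curve 3} (hc : c ∈ C3) :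
    ∃ q u, c.IsEndpt ((2 : ℝ) • toPt q) ∧ c.IsEndpt ((2 : ℝ) • toPt (q + dvec u)) := by
  obtain ⟨p, u, hp, h1, h2, -⟩ := hH.endpts hc
  obtain ⟨q, rfl⟩ := hp.exists_smul
  refine ⟨q, u, by rwa [← toPt_two_smul], ?_⟩
  rwa [← toPt_two_smul, smul_add]

lemma powers_segs (hH : SatH C3 2 4) (hP : PowersOf C3 2 P) (s : ℕ) :
    (traceOf (P s)).segs = {S | IsSeg S} := by
  induction s with
  | zero => rw [hP.2.1]; rfl
  | succ s ih =>
    rw [hP.2.2 s]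
    ext S
    constructor
    · rintro ⟨a, b, -, c, -, -, -, h⟩
      exact c.isSeg_of_mem h
    · intro h
      have h' : S ∈ (traceOf C3).segs := by rw [hH.segs_eq]; exact h
      obtain ⟨c, hc, h'⟩ := h'
      obtain ⟨q, u, h1, h2⟩ := exists_toPt_edge_endpts hH hc
      exact ⟨toPt q, toPt (q + dvec u), by rw [ih]; exact isSeg_edge q u, c, hc,
        by simpa using h1, by simpa using h2, h'⟩

lemma powers_rel_odd (hH : SatH C3 2 4) (hP : PowersOf C3 2 P) (s : ℕ) {p : Z3}
    (hp : ¬ MulOf 2 p) : (traceOf (P (s + 1))).rel p = (traceOf C3).rel p := by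
  funext u v
  refine propext ⟨fun h => ?_, ?_⟩
  · have huv := traceOf_conn_ne h
    unfold Trace.rel at h
    rw [hP.2.2 s] at h
    rcases h with ⟨a, b, -, c, hc, -, -, h⟩ | ⟨a, b, d, hb, c, hc, c', hc', -, -, -, -, h⟩
    · exact ⟨c, hc, h⟩
    · exfalso
      obtain ⟨r, x, y, rfl, -, -, -⟩ := conn_common hb
      rw [Nat.cast_ofNat, ← toPt_two_smul] at h
      apply hp
      rcases h with ⟨h1, h2⟩ | ⟨h1, h2⟩
      · obtain ⟨a1, e1, -⟩ := c.endSegAt_edge h1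
        obtain ⟨a2, e2, -⟩ := c'.endSegAt_edge h2
        rw [(edge_pair huv e1 e2).1]
        exact mulOf_two_smul r
      · obtain ⟨a1, e1, -⟩ := c.endSegAt_edge h1
        obtain ⟨a2, e2, -⟩ := c'.endSegAt_edge h2
        rw [(edge_pair huv e2 e1).1]
        exact mulOf_two_smul r
  · rintro ⟨c, hc, h⟩
    unfold Trace.rel
    rw [hP.2.2 s]
    obtain ⟨q, u, h1, h2⟩ := exists_toPt_edge_endpts hH hc
    exact Or.inl ⟨toPt q, toPt (q + dvec u),
      by rw [powers_segs hH hP]; exact isSeg_edge q u, c, hc, by simpa using h1,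
      by simpa using h2, h⟩

lemma powers_rel_even (hH : SatH C3 2 4) (hP : PowersOf C3 2 P) {w : Z3 → D6 → D6}
    (hbij : ∀ p, MulOf 2 p → Function.Bijective (w p))
    (hend : ∀ p, MulOf 2 p → ∀ u, ∀ c ∈ C3, c.IsEndpt (toPt p) →
      c.IsEndpt (toPt (p + 2 • dvec u)) → ∀ S, c.endSegAt (toPt p) S ↔ S = edge p (w p u))
    (s : ℕ) (q : Z3) (u v : D6) :
    (traceOf (P (s + 1))).rel (2 • q) (w (2 • q) u) (w (2 • q) v) ↔
      (traceOf (P s)).rel q u v := by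
  have cast2 : ((2 : ℕ) : ℝ) = 2 := by norm_num
  constructor
  · intro h
    have huv := traceOf_conn_ne h
    unfold Trace.rel at h
    rw [hP.2.2 s] at h
    rcases h with ⟨a, b, -, c, hc, -, -, h⟩ | ⟨a, b, d, hb, c, hc, c', hc', h1, h2, h3, h4, h5⟩
    · exact absurd ⟨c, hc, h⟩ (hH.not_conn_even (mulOf_two_smul q) _ _)
    · obtain ⟨r, x, y, rfl, rfl, rfl, hxy⟩ := conn_common hb
      simp only [cast2, ← toPt_two_smul, smul_add] at h1 h2 h3 h4 h5
      have hr := mulOf_two_smul r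
      rw [hend _ hr x c hc h2 h1, hend _ hr y c' hc' h3 h4, hend _ hr x c hc h2 h1,
        hend _ hr y c' hc' h3 h4] at h5
      have hcancel : 2 • q = 2 • r → q = r := by
        intro h
        funext i
        have := congrFun h i
        simpa using this
      rcases h5 with ⟨h5, h6⟩ | ⟨h5, h6⟩
      · obtain ⟨e1, e2, e3⟩ := edge_pair huv h5 h6
        obtain rfl := hcancel e1
        rwa [(hbij _ hr).1 e2, (hbij _ hr).1 e3]
      · obtain ⟨e1, e2, e3⟩ := edge_pair huv h6 h5
        obtain rfl := hcancel e1
        rw [(hbij _ hr).1 e2, (hbij _ hr).1 e3]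
        exact traceOf_conn_symm hxy
  · intro h
    unfold Trace.rel
    rw [hP.2.2 s]
    have hq := mulOf_two_smul q
    obtain ⟨⟨c, hc, c1, c2⟩, -⟩ := hH.curve_dir hq u
    obtain ⟨⟨d, hd, d1, d2⟩, -⟩ := hH.curve_dir hq v
    refine Or.inr ⟨toPt (q + dvec u), toPt q, toPt (q + dvec v), ?_, c, hc, d, hd, ?_⟩
    · rw [Sym2.eq_swap]; exact h
    · simp only [cast2, ← toPt_two_smul, smul_add]
      exact ⟨c2, c1, d1, d2, Or.inl ⟨(hend _ hq u c hc c1 c2 _).2 rfl,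
        (hend _ hq v d hd d1 d2 _).2 rfl⟩⟩

lemma rel_add (hH : SatH C3 2 4) (p : Z3) {t : Z3} (ht : MulOf 4 t) :
    (traceOf C3).rel (p + t) = (traceOf C3).rel p := by
  have key : ∀ p t u v, MulOf 4 t → (traceOf C3).rel p u v → (traceOf C3).rel (p + t) u v := by
    intro p t u v ht h
    have := hH.conn_add ht h
    rwa [map_add_edge, map_add_edge] at this
  funext u v
  refine propext ⟨fun h => ?_, key p t u v ht⟩
  have := key _ (-t) u v (fun i => (dvd_neg.2 (ht i))) h
  rwa [add_neg_cancel_right] at this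

lemma mulOf_one (p : Z3) : MulOf 1 p := fun _ => one_dvd _

lemma tower_powers (hC3 : traceOf C3 = CTrace) (hH : SatH C3 2 4) (hP : PowersOf C3 2 P) :
    Tower fun s => (traceOf (P s)).rel := by
  obtain ⟨w, hbij, hend, hper, htheta⟩ := exists_firstDir_theta hC3 hH
  have odd := fun s {p : Z3} (hp : ¬ MulOf 2 p) => powers_rel_odd hH hP s hp
  have even := powers_rel_even hH hP hbij hend
  have zero : ∀ p u v, ¬ (traceOf (P 0)).rel p u v := by
    intro p u v h
    unfold Trace.rel at h
    rw [hP.2.1] at h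
    exact h
  have none : ∀ s p, MulOf (2 ^ s) p → ∀ u v, ¬ (traceOf (P s)).rel p u v := by
    intro s
    induction s with
    | zero => exact fun p _ => zero p
    | succ s ih =>
      intro p hp u v h
      have hp2 : MulOf 2 p := hp.trans (dvd_pow_self 2 (Nat.succ_ne_zero s))
      obtain ⟨u, rfl⟩ := (hbij p hp2).2 u
      obtain ⟨v, rfl⟩ := (hbij p hp2).2 v
      obtain ⟨q, rfl⟩ := hp2.exists_smul
      rw [pow_succ', mulOf_double] at hp
      exact ih q hp u v ((even s q u v).1 h)
  refine ⟨?_, ?_, none, ?_, ?_, ?_, ?_, ?_⟩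
  · intro s
    induction s with
    | zero =>
      intro p z _
      funext u v
      exact propext ⟨fun h => absurd h (zero _ _ _), fun h => absurd h (zero _ _ _)⟩
    | succ s ih =>
      intro p z hz
      have hz4 : MulOf 4 z := hz.trans ⟨2 ^ s, by ring⟩
      have hz2 : MulOf 2 z := hz4.trans (by norm_num)
      by_cases hp : MulOf 2 p
      · funext u v
        obtain ⟨u, rfl⟩ := (hbij p hp).2 u
        obtain ⟨v, rfl⟩ := (hbij p hp).2 v
        obtain ⟨q, rfl⟩ := hp.exists_smul
        have hw := hper _ z hp hz4
        obtain ⟨y, rfl⟩ := hz2.exists_smul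
        rw [pow_succ', mulOf_double] at hz
        have e := even s (q + y) u v
        rw [smul_add, hw] at e
        refine propext ?_
        rw [e, even s q u v, ih q y hz]
      · have hpz : ¬ MulOf 2 (p + z) := fun h => hp (by simpa using h.sub hz2)
        rw [odd s hp, odd s hpz, rel_add hH p hz4]
  · intro s
    induction s with
    | zero => exact fun p hp => absurd (mulOf_one p) (by simpa using hp)
    | succ s ih =>
      intro p hp u
      by_cases hp2 : MulOf 2 p
      · obtain ⟨u, rfl⟩ := (hbij p hp2).2 u
        obtain ⟨q, rfl⟩ := hp2.exists_smul
        rw [pow_succ', mulOf_double] at hp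
        obtain ⟨v, hv⟩ := ih q hp u
        exact ⟨_, (even s q u v).2 hv⟩
      · rw [odd s hp2]
        exact hH.conn_odd hp2 u
  · intro s
    induction s with
    | zero => exact fun p u v h => absurd h (zero p u v)
    | succ s ih =>
      intro p u v h
      by_cases hp : MulOf 2 p
      · obtain ⟨u, rfl⟩ := (hbij p hp).2 u
        obtain ⟨v, rfl⟩ := (hbij p hp).2 v
        obtain ⟨q, rfl⟩ := hp.exists_smul
        exact (even (s + 1) q u v).2 (ih q u v ((even s q u v).1 h))
      · rw [odd (s + 1) hp]
        rwa [odd s hp] at h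
  · exact fun s p u v w h1 h2 => (hP.1 s).conn_unique h1 h2
  · exact fun s p u v h => traceOf_conn_symm h
  · exact fun s p u h => traceOf_conn_ne h rfl
  · intro s q u v hq
    have h4 : MulOf 4 (2 • q) := by
      rw [show (4 : ℤ) = 2 * 2 by norm_num, mulOf_double]; exact hq
    have := even s q u v
    rwa [htheta _ h4] at this

end Powers

/-- A field of relations on directions, indexed by the vertices of the lattice. -/
abbrev Field6 := Z3 → D6 → D6 → Prop

def InBox (N : ℕ) (p : Z3) : Prop := ∀ i, |p i| ≤ N

def hatF (Q : ℕ → Field6) : Field6 := fun p u v => ∃ s, Q s p u v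

def hatRF (Q : ℕ → Field6) (R : D6 → D6 → Prop) : Field6 :=
  fun p u v => hatF Q p u v ∨ (p = 0 ∧ R u v)

def hatXF (Q : ℕ → Field6) (x : ℕ → Z3) : Field6 :=
  fun p u v => ∃ s, 1 ≤ s ∧ Q s (p - x s) u v

/-- Every bounded region of `F` is a translate of a region of some `Q M` which avoids the
vertices without connexions. -/
def Finitary (Q : ℕ → Field6) (F : Field6) : Prop :=
  ∀ N, ∃ M a, ∀ p, InBox N p → ¬ MulOf (2 ^ M) (p + a) ∧ F p = Q M (p + a)

/-- A translate of each `Q M` is contained in `F`. -/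
def Containing (Q : ℕ → Field6) (F : Field6) : Prop :=
  ∀ M, ∃ a, ∀ p u v, Q M (p + a) u v → F p u v

def Functional (F : Field6) : Prop := ∀ p u v w, F p u v → F p u w → v = w

/-- Every bounded region of `F` is a translate of a region of `G`. -/
def LocSub (F G : Field6) : Prop := ∀ N, ∃ z, ∀ p, InBox N p → F p = G (p + z)

/-- Condition (P) in terms of direction labels. -/
def SatPF (Q : ℕ → Field6) (R : D6 → D6 → Prop) : Prop :=
  ∃ x : Z3, (∀ i, x i = -2 ∨ x i = 0 ∨ x i = 2 ∨ x i = 4) ∧ (¬ ∀ i, x i = 0 ∨ x i = 4) ∧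
    (hatF Q x = R ∨ hatF Q x = fun u v => R (thetaD u) (thetaD v))

lemma exists_not_mulOf {p : Z3} (hp : p ≠ 0) : ∃ s, ∀ s', s ≤ s' → ¬ MulOf (2 ^ s') p := by
  obtain ⟨i, hi⟩ := Function.ne_iff.1 hp
  refine ⟨(p i).natAbs, fun s' hs' h => hi ?_⟩
  refine Int.eq_zero_of_abs_lt_dvd (h i) ?_
  rw [Int.abs_eq_natAbs]
  have h1 : (p i).natAbs < 2 ^ (p i).natAbs := Nat.lt_two_pow_self
  have h2 : 2 ^ (p i).natAbs ≤ 2 ^ s' := Nat.pow_le_pow_right (by norm_num) hs'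
  exact_mod_cast h1.trans_le h2

lemma eq_of_sub {A B : D6 → D6 → Prop} (hfull : ∀ u, ∃ v, A u v) (hsub : ∀ u v, A u v → B u v)
    (hB : ∀ u v w, B u v → B u w → v = w) : A = B := by
  funext u v
  refine propext ⟨hsub u v, fun h => ?_⟩
  obtain ⟨v', hv'⟩ := hfull u
  rwa [hB u v v' h (hsub _ _ hv')]

lemma mulOf_zero (m : ℤ) : MulOf m 0 := fun _ => dvd_zero _

namespace Tower

variable {Q : ℕ → Field6} (hQ : Tower Q)
include hQ

lemma mono_le {s s' : ℕ} (h : s ≤ s') {p : Z3} {u v : D6} (hs : Q s p u v) : Q s' p u v := by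
  induction h with
  | refl => exact hs
  | step _ ih => exact hQ.mono _ _ _ _ ih

lemma hat_func : Functional (hatF Q) := by
  rintro p u v w ⟨s, hs⟩ ⟨s', hs'⟩
  exact hQ.func (max s s') p u v w (hQ.mono_le (le_max_left _ _) hs)
    (hQ.mono_le (le_max_right _ _) hs')

lemma hat_zero (u v : D6) : ¬ hatF Q 0 u v := by
  rintro ⟨s, h⟩
  exact hQ.none s 0 (mulOf_zero _) u v h

lemma hat_eq {s : ℕ} {p : Z3} (hp : ¬ MulOf (2 ^ s) p) : Q s p = hatF Q p :=
  eq_of_sub (hQ.full s p hp) (fun _ _ h => ⟨s, h⟩) (hQ.hat_func p)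

lemma hat_full {p : Z3} (hp : p ≠ 0) (u : D6) : ∃ v, hatF Q p u v := by
  obtain ⟨s, hs⟩ := exists_not_mulOf hp
  rw [← hQ.hat_eq (hs s le_rfl)]
  exact hQ.full s p (hs s le_rfl) u

omit hQ in
lemma hatR_ne (R : D6 → D6 → Prop) {p : Z3} (hp : p ≠ 0) : hatRF Q R p = hatF Q p := by
  funext u v; simp [hatRF, hp]

lemma hatR_zero (R : D6 → D6 → Prop) : hatRF Q R 0 = R := by
  funext u v; simp [hatRF, hQ.hat_zero]

lemma hat_theta {q : Z3} (hq : MulOf 2 q) (u v : D6) :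
    hatF Q (2 • q) (thetaD u) (thetaD v) ↔ hatF Q q u v := by
  constructor
  · rintro ⟨s, h⟩
    exact ⟨s, (hQ.theta s q u v hq).1 (hQ.mono _ _ _ _ h)⟩
  · rintro ⟨s, h⟩
    exact ⟨s + 1, (hQ.theta s q u v hq).2 h⟩

lemma hat_two {q : Z3} (hq : MulOf 2 q) :
    hatF Q (2 • q) = fun u v => hatF Q q (thetaD u) (thetaD v) := by
  funext u v
  rw [← hQ.hat_theta hq, thetaD_thetaD, thetaD_thetaD]

lemma hat_four_pow {q : Z3} (hq : MulOf 2 q) (k : ℕ) : hatF Q ((2 ^ (2 * k)) • q) = hatF Q q := by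
  induction k with
  | zero => simp
  | succ k ih =>
    have h1 : MulOf 2 ((2 ^ (2 * k)) • q) := fun i => by
      simpa using Dvd.dvd.mul_left (hq i) _
    have h2 : MulOf 2 (2 • (2 ^ (2 * k)) • q) := mulOf_two_smul _
    rw [show 2 ^ (2 * (k + 1)) • q = 2 • 2 • (2 ^ (2 * k)) • q by
      rw [smul_smul, smul_smul]; congr 1; ring, hQ.hat_two h2, hQ.hat_two h1, ih]
    simp only [thetaD_thetaD]

lemma satPF_hat {y : Z3} (hy : MulOf 2 y) (h0 : y ≠ 0) : SatPF Q (hatF Q y) := by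
  obtain ⟨s, hs⟩ := exists_not_mulOf h0
  replace hs := hs s le_rfl
  clear h0
  induction s generalizing y with
  | zero => exact absurd (mulOf_one y) (by simpa using hs)
  | succ s ih =>
    by_cases h4 : MulOf 4 y
    · obtain ⟨q, rfl⟩ := hy.exists_smul
      have hq : MulOf 2 q := by
        rwa [show (4 : ℤ) = 2 * 2 by norm_num, mulOf_double] at h4
      rw [pow_succ', mulOf_double] at hs
      obtain ⟨x, h1, h2, h3⟩ := ih hq hs
      refine ⟨x, h1, h2, ?_⟩
      rw [hQ.hat_two hq]
      simp only [thetaD_thetaD]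
      exact h3.symm
    · let x : Z3 := fun i => if y i % 8 = 6 then -2 else y i % 8
      have hx : ∀ i, x i = -2 ∨ x i = 0 ∨ x i = 2 ∨ x i = 4 := by
        intro i
        have := hy i
        simp only [x]
        split_ifs <;> omega
      have hxy : MulOf 8 (y - x) := by
        intro i
        simp only [Pi.sub_apply, x]
        split_ifs <;> omega
      have hx4 : ¬ MulOf 4 x := fun h => h4 (by simpa using (hxy.trans (by norm_num)).add h)
      refine ⟨x, hx, fun h => hx4 fun i => ?_, Or.inl ?_⟩
      · rcases h i with h | h <;> norm_num [h]
      · rw [← hQ.hat_eq (s := 2) (by simpa using hx4), ← hQ.hat_eq (s := 2) (by simpa using h4)]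
        rw [← hQ.per 2 x (y - x) (by simpa using hxy), add_sub_cancel]

omit hQ in
lemma exists_even_hat {R : D6 → D6 → Prop} (hR : SatPF Q R) :
    ∃ x, MulOf 2 x ∧ x ≠ 0 ∧ (hatF Q x = R ∨ hatF Q x = fun u v => R (thetaD u) (thetaD v)) := by
  obtain ⟨x, h1, h2, h3⟩ := hR
  refine ⟨x, fun i => ?_, ?_, h3⟩
  · rcases h1 i with h | h | h | h <;> rw [h] <;> norm_num
  · rintro rfl
    exact h2 fun i => Or.inl rfl

/-- A relation satisfying (P) occurs at arbitrarily divisible nonzero vertices. -/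
lemma recurrent {R : D6 → D6 → Prop} (hR : SatPF Q R) (M : ℕ) :
    ∃ a, a ≠ 0 ∧ MulOf (2 ^ (M + 1)) a ∧ hatF Q a = R := by
  have key : ∀ x, MulOf 2 x → x ≠ 0 → hatF Q x = R →
      ∃ a, a ≠ 0 ∧ MulOf (2 ^ (M + 1)) a ∧ hatF Q a = R := by
    intro x hx h0 h
    refine ⟨2 ^ (2 * M) • x, ?_, fun i => ?_, by rw [hQ.hat_four_pow hx, h]⟩
    · exact smul_ne_zero (by positivity) h0
    · have : (2 : ℤ) ^ (M + 1) ∣ 2 ^ (2 * M) * 2 := by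
        rw [← pow_succ]; exact pow_dvd_pow 2 (by omega)
      simpa using this.trans (mul_dvd_mul_left _ (hx i))
  obtain ⟨x, hx, h0, h | h⟩ := exists_even_hat hR
  · exact key x hx h0 h
  · refine key (2 • x) (mulOf_two_smul x) (smul_ne_zero (by norm_num) h0) ?_
    rw [hQ.hat_two hx, h]
    simp only [thetaD_thetaD]

lemma satPF_spec {R : D6 → D6 → Prop} (hR : SatPF Q R) :
    (∀ u v w, R u v → R u w → v = w) ∧ (∀ u, ∃ v, R u v) ∧ (∀ u v, R u v → R v u) ∧
      ∀ u, ¬ R u u := by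
  obtain ⟨a, h0, -, rfl⟩ := hQ.recurrent hR 0
  refine ⟨hQ.hat_func a, hQ.hat_full h0, ?_, ?_⟩
  · rintro u v ⟨s, h⟩; exact ⟨s, hQ.symm _ _ _ _ h⟩
  · rintro u ⟨s, h⟩; exact hQ.irrefl _ _ _ h

lemma hatR_func {R : D6 → D6 → Prop} (hR : SatPF Q R) : Functional (hatRF Q R) := by
  intro p
  by_cases hp : p = 0
  · rw [hp, hQ.hatR_zero]; exact (hQ.satPF_spec hR).1
  · rw [hatR_ne R hp]; exact hQ.hat_func p

omit hQ in
lemma hatR_containing (R : D6 → D6 → Prop) : Containing Q (hatRF Q R) :=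
  fun M => ⟨0, fun p u v h => Or.inl ⟨M, by simpa using h⟩⟩

lemma hatR_finitary {R : D6 → D6 → Prop} (hR : SatPF Q R) : Finitary Q (hatRF Q R) := by
  intro N
  obtain ⟨a, h0, ha, haR⟩ := hQ.recurrent hR N
  obtain ⟨s, hs⟩ := exists_not_mulOf h0
  refine ⟨max s N, a, fun p hp => ?_⟩
  by_cases hp0 : p = 0
  · subst hp0
    have := hs (max s N) (le_max_left _ _)
    rw [zero_add, hQ.hatR_zero, hQ.hat_eq this]
    exact ⟨this, haR.symm⟩
  · have hpN : ¬ MulOf (2 ^ N) p := by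
      intro h
      apply hp0
      funext i
      refine Int.eq_zero_of_abs_lt_dvd (h i) ((hp i).trans_lt ?_)
      exact_mod_cast Nat.lt_two_pow_self
    have hpa : ¬ MulOf (2 ^ N) (p + a) := fun h =>
      hpN (by simpa using h.sub (ha.trans (pow_dvd_pow 2 (Nat.le_succ N))))
    have hpM : ¬ MulOf (2 ^ max s N) (p + a) := fun h =>
      hpa (h.trans (pow_dvd_pow 2 (le_max_right _ _)))
    refine ⟨hpM, ?_⟩
    rw [hatR_ne R hp0, hQ.hat_eq hpM, ← hQ.hat_eq hpN, ← hQ.hat_eq hpa, hQ.per N p a ha]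

variable {x : ℕ → Z3} (hx : ∀ s, 1 ≤ s → MulOf (2 ^ (s + 1)) (x (s + 1) - x s))
include hx

lemma hatX_mono {s s' : ℕ} (h1 : 1 ≤ s) (h : s ≤ s') {p : Z3} {u v : D6}
    (hs : Q s (p - x s) u v) : Q s' (p - x s') u v := by
  induction h with
  | refl => exact hs
  | @step m hm ih =>
    have := hQ.mono _ _ _ _ ih
    refine hQ.mono _ _ _ _ ?_
    rw [← hQ.per m (p - x (m + 1)) (x (m + 1) - x m) (hx m (h1.trans hm))]
    simpa using ih

lemma hatX_func : Functional (hatXF Q x) := by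
  rintro p u v w ⟨s, h1, hs⟩ ⟨s', h1', hs'⟩
  exact hQ.func (max s s') _ u v w (hQ.hatX_mono hx h1 (le_max_left _ _) hs)
    (hQ.hatX_mono hx h1' (le_max_right _ _) hs')

omit hx in
lemma hatX_containing : Containing Q (hatXF Q x) := by
  intro M
  refine ⟨-x (M + 1), fun p u v h => ⟨M + 1, by omega, ?_⟩⟩
  rw [← sub_eq_add_neg] at h
  exact hQ.mono _ _ _ _ h

omit hQ in
lemma not_mulOf_of_le {p : Z3} {s : ℕ} (h1 : 1 ≤ s) (hs : ¬ MulOf (2 ^ (s + 1)) (p - x s))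
    {s' : ℕ} (h : s + 1 ≤ s') : ¬ MulOf (2 ^ s') (p - x s') := by
  have key : ∀ s', s ≤ s' → MulOf (2 ^ (s + 1)) (x s' - x s) := by
    intro s' h
    induction h with
    | refl => simpa using mulOf_zero _
    | @step m hm ih =>
      have := (hx m (h1.trans hm)).trans (pow_dvd_pow 2 (Nat.succ_le_succ hm))
      simpa using this.add ih
  intro h'
  apply hs
  have := (h'.trans (pow_dvd_pow 2 h)).add (key s' (by omega))
  simpa using this

lemma hatX_finitary (hx0 : ∀ p, ∃ s, 1 ≤ s ∧ ¬ MulOf (2 ^ (s + 1)) (p - x s)) :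
    Finitary Q (hatXF Q x) := by
  intro N
  have hfin : {p : Z3 | InBox N p}.Finite := by
    refine (Set.finite_Icc (fun _ => -(N : ℤ)) (fun _ => (N : ℤ))).subset fun p hp => ?_
    exact ⟨fun i => (abs_le.1 (hp i)).1, fun i => (abs_le.1 (hp i)).2⟩
  have hev : ∀ᶠ M in Filter.atTop, ∀ p ∈ {p : Z3 | InBox N p}, ¬ MulOf (2 ^ M) (p - x M) := by
    rw [hfin.eventually_all]
    intro p _
    obtain ⟨s, h1, hs⟩ := hx0 p
    exact Filter.eventually_atTop.2 ⟨s + 1, fun s' h => not_mulOf_of_le hx h1 hs h⟩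
  obtain ⟨M, hM, hM1⟩ := (hev.and (Filter.eventually_ge_atTop 1)).exists
  refine ⟨M, -x M, fun p hp => ?_⟩
  rw [← sub_eq_add_neg]
  refine ⟨hM p hp, Eq.symm ?_⟩
  exact eq_of_sub (hQ.full _ _ (hM p hp)) (fun u v h => ⟨M, hM1, h⟩) (hQ.hatX_func hx p)

omit hx

lemma locSub {F G : Field6} (hF : Finitary Q F) (hG : Containing Q G) (hG' : Functional G) :
    LocSub F G := by
  intro N
  obtain ⟨M, a, ha⟩ := hF N
  obtain ⟨b, hb⟩ := hG M
  refine ⟨a - b, fun p hp => ?_⟩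
  obtain ⟨h1, h2⟩ := ha p hp
  rw [h2]
  refine eq_of_sub (hQ.full _ _ h1) (fun u v h => hb _ u v ?_) (hG' _)
  rwa [add_assoc, sub_add_cancel]

end Tower

lemma InBox.add {N K : ℕ} {p t : Z3} (hp : InBox N p) (ht : InBox K t) : InBox (N + K) (p + t) := by
  intro i
  push_cast
  exact (abs_add_le _ _).trans (add_le_add (hp i) (ht i))

lemma exists_inBox (p : Z3) : ∃ N, InBox N p := by
  refine ⟨∑ i, (p i).natAbs, fun i => ?_⟩
  rw [Int.abs_eq_natAbs]
  exact_mod_cast Finset.single_le_sum (f := fun i => (p i).natAbs) (fun _ _ => Nat.zero_le _)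
    (Finset.mem_univ i)

lemma InBox.mono {N K : ℕ} {p : Z3} (hp : InBox N p) (h : N ≤ K) : InBox K p :=
  fun i => (hp i).trans (by exact_mod_cast h)

lemma Finitary.shift {Q : ℕ → Field6} {F : Field6} (hF : Finitary Q F) (t : Z3) :
    Finitary Q fun p => F (p - t) := by
  intro N
  obtain ⟨K, hK⟩ := exists_inBox (-t)
  obtain ⟨M, a, ha⟩ := hF (N + K)
  refine ⟨M, a - t, fun p hp => ?_⟩
  have := ha (p - t) (by rw [sub_eq_add_neg]; exact hp.add hK)
  rwa [show p + (a - t) = p - t + a by ring]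

lemma Containing.shift {Q : ℕ → Field6} {F : Field6} (hF : Containing Q F) (t : Z3) :
    Containing Q fun p => F (p - t) := by
  intro M
  obtain ⟨a, ha⟩ := hF M
  refine ⟨a - t, fun p u v h => ha _ u v ?_⟩
  rwa [show p - t + a = p + (a - t) by ring]

/-- A sequence of lattice points has a residue class modulo `m` taken along an ultrafilter. -/
lemma exists_residue (U : Ultrafilter ℕ) (w : ℕ → Z3) (m : ℕ) [NeZero m] :
    ∃ x, ∀ᶠ n in U, MulOf m (w n + x) := by
  let f : ℕ → Fin 3 → ZMod m := fun n i => (w n i : ZMod m)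
  obtain ⟨c, hc⟩ := (U.map f).eq_pure_of_finite
  have hc' : ∀ᶠ n in U, f n = c := by
    have : ({c} : Set (Fin 3 → ZMod m)) ∈ U.map f := by
      rw [hc]; exact Set.mem_singleton c
    exact this
  obtain ⟨n, hn⟩ := hc'.exists
  refine ⟨-w n, hc'.mono fun k hk i => ?_⟩
  have := congrFun (hk.trans hn.symm) i
  simp only [f] at this
  rw [← sub_eq_add_neg, Pi.sub_apply]
  exact (ZMod.intCast_eq_intCast_iff_dvd_sub _ _ _).1 this.symm

/-- The fields all of whose bounded regions occur in `hatRF Q R`. -/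
lemma Tower.classify {Q : ℕ → Field6} (hQ : Tower Q) {R : D6 → D6 → Prop} (hR : SatPF Q R)
    {F : Field6} (hF : LocSub F (hatRF Q R)) :
    (∃ S t, SatPF Q S ∧ ∀ p, F p = hatRF Q S (p - t)) ∨
    ∃ x : ℕ → Z3, (∀ s, 1 ≤ s → MulOf (2 ^ (s + 1)) (x (s + 1) - x s)) ∧
      (∀ p, ∃ s, 1 ≤ s ∧ ¬ MulOf (2 ^ (s + 1)) (p - x s)) ∧ F = hatXF Q x := by
  choose w hw using hF
  let U : Ultrafilter ℕ := Filter.hyperfilter ℕ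
  have hU : ∀ N, ∀ᶠ n in U, N ≤ n := fun N => by
    have : (U : Filter ℕ) ≤ Filter.atTop := by
      rw [← Nat.cofinite_eq_atTop]; exact Filter.hyperfilter_le_cofinite
    exact this (Filter.eventually_ge_atTop N)
  have hres : ∀ m : ℕ, ∃ x, ∀ᶠ n in U, MulOf (2 ^ (m + 1)) (w n + x) := fun m => by
    simpa using exists_residue U w (2 ^ (m + 1))
  choose x hx using hres
  have hxx : ∀ s, 1 ≤ s → MulOf (2 ^ (s + 1)) (x (s + 1) - x s) := by
    intro s _
    obtain ⟨n, h1, h2⟩ := ((hx s).and (hx (s + 1))).exists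
    have := (h2.trans (pow_dvd_pow 2 (Nat.le_succ _))).sub h1
    simpa using this
  have hloc : ∀ p m, ∃ n, F p = hatRF Q R (p + w n) ∧ MulOf (2 ^ (m + 1)) (w n + x m) := by
    intro p m
    obtain ⟨N, hN⟩ := exists_inBox p
    obtain ⟨n, h1, h2⟩ := ((hU N).and (hx m)).exists
    exact ⟨n, hw n p (hN.mono h1), h2⟩
  have hfunc : Functional F := by
    intro p
    obtain ⟨n, h1, -⟩ := hloc p 0
    rw [h1]
    exact hQ.hatR_func hR _
  have hsub : ∀ m p u v, Q m (p - x m) u v → F p u v := by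
    intro m p u v h
    obtain ⟨n, h1, h2⟩ := hloc p m
    rw [← hQ.per m (p - x m) _ h2, show p - x m + (w n + x m) = p + w n by ring] at h
    rw [h1]
    exact Or.inl ⟨m, h⟩
  by_cases hcap : ∀ p, ∃ s, 1 ≤ s ∧ ¬ MulOf (2 ^ (s + 1)) (p - x s)
  · refine Or.inr ⟨x, hxx, hcap, funext fun p => Eq.symm ?_⟩
    obtain ⟨s, h1, h2⟩ := hcap p
    have h3 := Tower.not_mulOf_of_le hxx h1 h2 le_rfl
    refine eq_of_sub (fun u => ?_) ?_ (hfunc p)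
    · obtain ⟨v, hv⟩ := hQ.full _ _ h3 u
      exact ⟨v, s + 1, by omega, hv⟩
    · rintro u v ⟨s, -, h⟩
      exact hsub s p u v h
  · push Not at hcap
    obtain ⟨t, ht⟩ := hcap
    refine Or.inl ⟨F t, t, ?_, fun p => ?_⟩
    · obtain ⟨n, h1, h2⟩ := hloc t 1
      have h3 : MulOf 2 (t + w n) := by
        have := ((ht 1 le_rfl).add h2).trans (show (2 : ℤ) ∣ 2 ^ (1 + 1) by norm_num)
        rwa [show t - x 1 + (w n + x 1) = t + w n by ring] at this
      rw [h1]
      by_cases h0 : t + w n = 0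
      · rw [h0, hQ.hatR_zero]; exact hR
      · rw [hatR_ne R h0]; exact hQ.satPF_hat h3 h0
    · by_cases hp : p - t = 0
      · rw [hp, hQ.hatR_zero, sub_eq_zero.1 hp]
      · obtain ⟨s, hs⟩ := exists_not_mulOf hp
        have hs' := hs (s + 1) (by omega)
        rw [hatR_ne _ hp, ← hQ.hat_eq hs']
        symm
        refine eq_of_sub (hQ.full _ _ hs') (fun u v h => hsub (s + 1) p u v ?_) (hfunc p)
        rw [← hQ.per (s + 1) (p - t) _ (ht (s + 1) (by omega))] at h
        simpa using h

/-- The trace contains all the lattice segments, and connects only segments with a common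
endpoint. -/
structure Trace.Full (T : Trace 3) : Prop where
  segs_eq : T.segs = {S | IsSeg S}
  adj : ∀ S S', T.conn S S' → ∃ p u v, u ≠ v ∧ S = edge p u ∧ S' = edge p v

namespace Trace.Full

variable {T T' : Trace 3}

lemma ext (hT : T.Full) (hT' : T'.Full) (h : T.rel = T'.rel) : T = T' := by
  have key : ∀ {T T' : Trace 3}, T.Full → T.rel = T'.rel →
      ∀ S S', T.conn S S' → T'.conn S S' := by
    intro T T' hT h S S' hS
    obtain ⟨p, u, v, -, rfl, rfl⟩ := hT.adj _ _ hS
    change T'.rel p u v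
    rw [← h]
    exact hS
  have hs := hT.segs_eq.trans hT'.segs_eq.symm
  have hc : T.conn = T'.conn := by
    funext S S'
    exact propext ⟨key hT h S S', key hT' h.symm S S'⟩
  cases T; cases T'
  exact congrArg₂ _ hs hc

lemma transl (hT : T.Full) (t : Z3) : (T.transl (toPt t)).Full := by
  refine ⟨?_, ?_⟩
  · ext S
    simp only [Trace.transl, Trace.map, hT.segs_eq, mem_image, mem_ofPred_eq, isSeg_iff]
    constructor
    · rintro ⟨_, ⟨p, u, rfl⟩, rfl⟩
      exact ⟨p + t, u, map_add_edge _ _ _⟩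
    · rintro ⟨p, u, rfl⟩
      exact ⟨_, ⟨p - t, u, rfl⟩, by rw [map_add_edge, sub_add_cancel]⟩
  · rintro _ _ ⟨A, B, h, rfl, rfl⟩
    obtain ⟨p, u, v, huv, rfl, rfl⟩ := hT.adj _ _ h
    exact ⟨p + t, u, v, huv, map_add_edge _ _ _, map_add_edge _ _ _⟩

end Trace.Full

lemma Trace.rel_transl {T : Trace 3} (hT : ∀ S S', T.conn S S' →
    ∃ p u v, u ≠ v ∧ S = edge p u ∧ S' = edge p v) (t p : Z3) :
    (T.transl (toPt t)).rel p = T.rel (p - t) := by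
  funext u v
  refine propext ⟨?_, fun h => ⟨_, _, h, ?_, ?_⟩⟩
  · rintro ⟨A, B, h, hu, hv⟩
    obtain ⟨q, a, b, hab, rfl, rfl⟩ := hT _ _ h
    rw [map_add_edge] at hu hv
    obtain ⟨rfl, rfl, rfl⟩ := edge_pair hab hu.symm hv.symm
    simpa [Trace.rel] using h
  · rw [map_add_edge, sub_add_cancel]
  · rw [map_add_edge, sub_add_cancel]

lemma edge_zero (u : D6) : edge 0 u = s((0 : Pt 3), toPt (dvec u)) := by
  simp [edge, toPt_zero]

section Powers

variable {C3 : Set (Curve 3)} {P : ℕ → Set (Curve 3)}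

lemma hatTrace_full (hH : SatH C3 2 4) (hP : PowersOf C3 2 P) : (hatTrace P).Full := by
  refine ⟨?_, ?_⟩
  · ext S
    simp [hatTrace, powers_segs hH hP]
  · rintro S S' ⟨s, h⟩
    exact traceOf_conn_adj h

lemma hatRTrace_full (hH : SatH C3 2 4) (hP : PowersOf C3 2 P) {R : Pt 3 → Pt 3 → Prop}
    (hR : IsPairing R) : (hatRTrace P R).Full := by
  refine ⟨(hatTrace_full hH hP).segs_eq, ?_⟩
  rintro S S' (h | ⟨u, v, h, rfl, rfl⟩)
  · exact (hatTrace_full hH hP).adj _ _ h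
  · obtain ⟨hu, hv⟩ := hR.2.1 _ _ h
    obtain ⟨a, rfl⟩ := isDir_iff.1 hu
    obtain ⟨b, rfl⟩ := isDir_iff.1 hv
    exact ⟨0, a, b, by rintro rfl; exact hR.2.2.1 _ h, (edge_zero a).symm, (edge_zero b).symm⟩

lemma hatXTrace_full (hH : SatH C3 2 4) (hP : PowersOf C3 2 P) {x : ℕ → Pt 3} {x' : ℕ → Z3}
    (hx : ∀ s, 1 ≤ s → x s = toPt (x' s)) : (hatXTrace P x).Full := by
  have key : ∀ s, 1 ≤ s → (Trace.transl (x s) (traceOf (P s))).Full := fun s hs => by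
    rw [hx s hs]
    exact Trace.Full.transl ⟨powers_segs hH hP s, fun _ _ h => traceOf_conn_adj h⟩ _
  refine ⟨?_, ?_⟩
  · ext S
    constructor
    · rintro ⟨s, hs, h⟩
      rwa [(key s hs).segs_eq] at h
    · intro h
      exact ⟨1, le_rfl, by rwa [(key 1 le_rfl).segs_eq]⟩
  · rintro S S' ⟨s, hs, h⟩
    exact (key s hs).adj _ _ h

lemma rel_hatTrace : (hatTrace P).rel = hatF fun s => (traceOf (P s)).rel := rfl

/-- The relation on direction labels corresponding to a relation on directions. -/
def onLabels (R : Pt 3 → Pt 3 → Prop) : D6 → D6 → Prop :=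
  fun u v => R (toPt (dvec u)) (toPt (dvec v))

lemma rel_hatRTrace {R : Pt 3 → Pt 3 → Prop} (hR : IsPairing R) :
    (hatRTrace P R).rel = hatRF (fun s => (traceOf (P s)).rel) (onLabels R) := by
  funext p u v
  refine propext (or_congr Iff.rfl ⟨?_, ?_⟩)
  · rintro ⟨u', v', h, hu, hv⟩
    obtain ⟨hu', hv'⟩ := hR.2.1 _ _ h
    obtain ⟨a, rfl⟩ := isDir_iff.1 hu'
    obtain ⟨b, rfl⟩ := isDir_iff.1 hv'
    have hab : a ≠ b := by rintro rfl; exact hR.2.2.1 _ h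
    rw [← edge_zero] at hu hv
    obtain ⟨rfl, rfl, rfl⟩ := edge_pair hab hu.symm hv.symm
    exact ⟨rfl, h⟩
  · rintro ⟨rfl, h⟩
    exact ⟨_, _, h, edge_zero _, edge_zero _⟩

lemma rel_hatXTrace {x : ℕ → Pt 3} {x' : ℕ → Z3} (hx : ∀ s, 1 ≤ s → x s = toPt (x' s)) :
    (hatXTrace P x).rel = hatXF (fun s => (traceOf (P s)).rel) x' := by
  funext p u v
  refine propext (exists_congr fun s => and_congr_right fun hs => ?_)
  rw [hx s hs]
  exact iff_of_eq (congrFun₂ (Trace.rel_transl (fun _ _ h => traceOf_conn_adj h) _ _) u v)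

/-- The relation on directions corresponding to a relation on direction labels. -/
def onDirs (S : D6 → D6 → Prop) : Pt 3 → Pt 3 → Prop :=
  fun u v => ∃ a b, u = toPt (dvec a) ∧ v = toPt (dvec b) ∧ S a b

lemma onDirs_iff {S : D6 → D6 → Prop} {a b : D6} :
    onDirs S (toPt (dvec a)) (toPt (dvec b)) ↔ S a b := by
  constructor
  · rintro ⟨a', b', ha, hb, h⟩
    rwa [dvec_injective (toPt_inj.1 ha), dvec_injective (toPt_inj.1 hb)]
  · exact fun h => ⟨a, b, rfl, rfl, h⟩

lemma onLabels_onDirs (S : D6 → D6 → Prop) : onLabels (onDirs S) = S := by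
  funext a b
  exact propext onDirs_iff

lemma onDirs_onLabels {R : Pt 3 → Pt 3 → Prop} (hR : ∀ u v, R u v → IsDir u ∧ IsDir v) :
    onDirs (onLabels R) = R := by
  funext u v
  refine propext ⟨?_, fun h => ?_⟩
  · rintro ⟨a, b, rfl, rfl, h⟩
    exact h
  · obtain ⟨hu, hv⟩ := hR _ _ h
    obtain ⟨a, rfl⟩ := isDir_iff.1 hu
    obtain ⟨b, rfl⟩ := isDir_iff.1 hv
    exact ⟨a, b, rfl, rfl, h⟩

lemma isDir_theta3 {u : Pt 3} (h : IsDir (theta3 u)) : IsDir u := by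
  by_contra hu
  rw [theta3_of_not_isDir hu] at h
  exact hu h

lemma onLabels_Rtheta (R : Pt 3 → Pt 3 → Prop) :
    onLabels (Rtheta R) = fun a b => onLabels R (thetaD a) (thetaD b) := by
  funext a b
  simp only [onLabels, Rtheta, theta3_toPt]

lemma onLabels_Rx (x : Z3) :
    onLabels (Rx P (toPt x)) = hatF (fun s => (traceOf (P s)).rel) x := by
  funext a b
  simp only [onLabels, Rx, ← rel_hatTrace, Trace.rel, edge, toPt_add]

lemma isDir_Rx (hH : SatH C3 2 4) (hP : PowersOf C3 2 P) (x : Z3) (u v : Pt 3)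
    (h : Rx P (toPt x) u v) : IsDir u ∧ IsDir v := by
  obtain ⟨p, a, b, hab, hu, hv⟩ := (hatTrace_full hH hP).adj _ _ h
  have key : ∀ {w : Pt 3} {c : D6}, s(toPt x, toPt x + w) = edge p c → IsDir w := by
    intro w c h
    obtain ⟨d, hd⟩ := edge_of_mem (p := x) (q := p) (u := c) (h ▸ Sym2.mem_mk_left _ _)
    rw [hd, edge, toPt_add] at h
    refine isDir_iff.2 ⟨d, ?_⟩
    have := Sym2.congr_right.1 h
    exact add_left_cancel this
  exact ⟨key hu, key hv⟩

lemma satP_iff (hH : SatH C3 2 4) (hP : PowersOf C3 2 P) {R : Pt 3 → Pt 3 → Prop}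
    (hR : ∀ u v, R u v → IsDir u ∧ IsDir v) :
    SatP P R ↔ SatPF (fun s => (traceOf (P s)).rel) (onLabels R) := by
  have inj : ∀ {A B : Pt 3 → Pt 3 → Prop}, (∀ u v, A u v → IsDir u ∧ IsDir v) →
      (∀ u v, B u v → IsDir u ∧ IsDir v) → (A = B ↔ onLabels A = onLabels B) := by
    intro A B hA hB
    refine ⟨fun h => h ▸ rfl, fun h => ?_⟩
    rw [← onDirs_onLabels hA, h, onDirs_onLabels hB]
  have hRθ : ∀ u v, Rtheta R u v → IsDir u ∧ IsDir v := fun u v h =>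
    ⟨isDir_theta3 (hR _ _ h).1, isDir_theta3 (hR _ _ h).2⟩
  have key : ∀ x : Z3, (Rx P (toPt x) = R ∨ Rx P (toPt x) = Rtheta R) ↔
      (hatF (fun s => (traceOf (P s)).rel) x = onLabels R ∨
        hatF (fun s => (traceOf (P s)).rel) x =
          fun u v => onLabels R (thetaD u) (thetaD v)) := by
    intro x
    rw [inj (isDir_Rx hH hP x) hR, inj (isDir_Rx hH hP x) hRθ, onLabels_Rx, onLabels_Rtheta]
  have h24 : ∀ z : ℤ, ((z : ℝ) = -2 ∨ (z : ℝ) = 0 ∨ (z : ℝ) = 2 ∨ (z : ℝ) = 4) ↔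
      (z = -2 ∨ z = 0 ∨ z = 2 ∨ z = 4) := fun z => by norm_cast
  have h4 : ∀ z : ℤ, ((z : ℝ) = 0 ∨ (z : ℝ) = 4) ↔ (z = 0 ∨ z = 4) := fun z => by norm_cast
  constructor
  · rintro ⟨x, h1, h2, h3⟩
    have hx : latt x := fun i => by
      rcases h1 i with h | h | h | h
      exacts [⟨-2, by simp [h]⟩, ⟨0, by simp [h]⟩, ⟨2, by simp [h]⟩, ⟨4, by simp [h]⟩]
    obtain ⟨z, rfl⟩ := latt_iff.1 hx
    simp only [toPt_apply, h24, h4] at h1 h2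
    exact ⟨z, h1, h2, (key z).1 h3⟩
  · rintro ⟨z, h1, h2, h3⟩
    refine ⟨toPt z, ?_, ?_, (key z).2 h3⟩
    · simpa only [toPt_apply, h24] using h1
    · simpa only [toPt_apply, h4] using h2

lemma isPairing_onDirs {S : D6 → D6 → Prop} (hfun : ∀ u v w, S u v → S u w → v = w)
    (hfull : ∀ u, ∃ v, S u v) (hsymm : ∀ u v, S u v → S v u) (hirr : ∀ u, ¬ S u u) :
    IsPairing (onDirs S) := by
  refine ⟨?_, ?_, ?_, ?_⟩
  · rintro _ _ ⟨a, b, rfl, rfl, h⟩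
    exact ⟨b, a, rfl, rfl, hsymm _ _ h⟩
  · rintro _ _ ⟨a, b, rfl, rfl, h⟩
    exact ⟨isDir_iff.2 ⟨a, rfl⟩, isDir_iff.2 ⟨b, rfl⟩⟩
  · rintro u ⟨a, b, rfl, hb, h⟩
    rw [dvec_injective (toPt_inj.1 hb)] at h
    exact hirr _ h
  · intro u hu
    obtain ⟨a, rfl⟩ := isDir_iff.1 hu
    obtain ⟨b, hb⟩ := hfull a
    refine ⟨_, onDirs_iff.2 hb, ?_⟩
    rintro _ ⟨a', c, ha, rfl, h⟩
    rw [← dvec_injective (toPt_inj.1 ha)] at h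
    rw [hfun _ _ _ h hb]

end Powers

/-- The union of the lattice segments. -/
def grid : Set (Pt 3) := {x | ∃ i, ∀ j, j ≠ i → ∃ m : ℤ, x j = m}

lemma norm_le_of_coord {x : Pt 3} {c : ℝ} (hc : 0 ≤ c) (h : ∀ i, |x i| ≤ c) : ‖x‖ ≤ 2 * c := by
  refine le_of_sq_le_sq ?_ (by positivity)
  rw [EuclideanSpace.norm_sq_eq, Fin.sum_univ_three]
  have h2 : ∀ i, ‖x i‖ ^ 2 ≤ c ^ 2 := fun i =>
    pow_le_pow_left₀ (norm_nonneg _) (by simpa using h i) 2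
  nlinarith [h2 0, h2 1, h2 2, sq_nonneg c]

lemma abs_coord_le_norm (x : Pt 3) (i : Fin 3) : |x i| ≤ ‖x‖ := by
  simpa using PiLp.norm_apply_le x i

lemma left_mem_segPts (p : Z3) (u : D6) : toPt p ∈ segPts (edge p u) :=
  ⟨_, _, rfl, 0, le_rfl, zero_le_one, by simp⟩

lemma segPts_subset_of_convex {a b : Pt 3} {K : Set (Pt 3)} (hK : Convex ℝ K) (ha : a ∈ K)
    (hb : b ∈ K) : segPts s(a, b) ⊆ K := by
  rintro _ ⟨a', b', h, t, h0, h1, rfl⟩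
  rcases Sym2.eq_iff.1 h with ⟨rfl, rfl⟩ | ⟨rfl, rfl⟩
  · exact hK.add_smul_sub_mem ha hb ⟨h0, h1⟩
  · exact hK.add_smul_sub_mem hb ha ⟨h0, h1⟩

lemma segPts_subset_grid {S : Sym2 (Pt 3)} (hS : IsSeg S) : segPts S ⊆ grid := by
  obtain ⟨x, i, hx, rfl⟩ := hS
  rintro _ ⟨a, b, h, t, -, -, rfl⟩
  refine ⟨i, fun j hj => ?_⟩
  rcases Sym2.eq_iff.1 h with ⟨rfl, rfl⟩ | ⟨rfl, rfl⟩
  · simpa [uvec, hj] using hx j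
  · simpa [uvec, hj] using hx j

lemma grid_subset {T : Trace 3} (hT : T.segs = {S | IsSeg S}) : grid ⊆ T.pts := by
  rintro x ⟨i, hi⟩
  let q : Z3 := fun j => ⌊x j⌋
  have hS : IsSeg s(toPt q, toPt q + uvec 3 i) := ⟨toPt q, i, latt_toPt _, rfl⟩
  refine mem_iUnion₂.2 ⟨_, by rw [hT]; exact hS, _, _, rfl, Int.fract (x i), Int.fract_nonneg _,
    (Int.fract_lt_one _).le, ?_⟩
  ext j
  by_cases hj : j = i
  · subst hj
    simp [uvec, q, toPt_apply]
  · obtain ⟨m, hm⟩ := hi j hj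
    simp [uvec, q, toPt_apply, hj, hm]

lemma pts_subset_grid {T : Trace 3} (hT : ∀ S ∈ T.segs, IsSeg S) : T.pts ⊆ grid :=
  iUnion₂_subset fun S hS => segPts_subset_grid (hT S hS)

lemma Trace.Full.pts_eq {T : Trace 3} (hT : T.Full) : T.pts = grid :=
  (pts_subset_grid fun S hS => by rwa [hT.segs_eq] at hS).antisymm (grid_subset hT.segs_eq)

lemma add_mem_grid {x : Pt 3} (hx : x ∈ grid) (z : Z3) : x + toPt z ∈ grid := by
  obtain ⟨i, hi⟩ := hx
  refine ⟨i, fun j hj => ?_⟩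
  obtain ⟨m, hm⟩ := hi j hj
  exact ⟨m + z j, by simp [hm, toPt_apply]⟩

/-- Traces whose relations agree up to translation on bounded regions have the same balls. -/
lemma Trace.Full.exists_ballIso {T T' : Trace 3} (hT : T.Full) (hT' : T'.Full)
    (h : LocSub T.rel T'.rel) (x : Pt 3) (r : ℝ) : ∃ y, BallIso T x T' y r := by
  obtain ⟨N, hN⟩ := exists_nat_ge (r + ‖x‖)
  have hbox : ∀ p : Z3, toPt p ∈ Metric.closedBall x r → InBox N p := by
    intro p hp i
    rw [mem_closedBall_iff_norm] at hp
    have h1 := abs_coord_le_norm (toPt p) i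
    have h2 : ‖toPt p‖ ≤ N := by
      calc ‖toPt p‖ = ‖toPt p - x + x‖ := by rw [sub_add_cancel]
        _ ≤ ‖toPt p - x‖ + ‖x‖ := norm_add_le _ _
        _ ≤ N := by linarith
    have h3 := h1.trans h2
    rw [toPt_apply, ← Int.cast_abs, ← Int.cast_natCast] at h3
    exact Int.cast_le.1 h3
  have hmem : ∀ {c : Pt 3} {p : Z3} {u : D6}, segPts (edge p u) ⊆ Metric.closedBall c r →
      toPt p ∈ Metric.closedBall c r := fun h => h (left_mem_segPts _ _)
  obtain ⟨z, hz⟩ := h N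
  refine ⟨x + toPt z, ?_, ?_, ?_⟩
  · rw [hT.pts_eq, hT'.pts_eq, add_sub_cancel_left]
    ext q
    constructor
    · rintro ⟨p, ⟨hp, hpr⟩, rfl⟩
      refine ⟨add_mem_grid hp z, ?_⟩
      rw [mem_closedBall_iff_norm] at hpr ⊢
      simpa using hpr
    · rintro ⟨hq, hqr⟩
      refine ⟨q - toPt z, ⟨?_, ?_⟩, sub_add_cancel _ _⟩
      · simpa [sub_eq_add_neg, toPt_neg] using add_mem_grid hq (-z)
      · rw [mem_closedBall_iff_norm] at hqr ⊢
        rwa [sub_sub, add_comm (toPt z)]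
  · intro S S' hS hr _
    obtain ⟨p, u, v, -, rfl, rfl⟩ := hT.adj _ _ hS
    rw [add_sub_cancel_left, map_add_edge, map_add_edge]
    change T'.rel (p + z) u v
    rw [← hz p (hbox p (hmem hr))]
    exact hS
  · intro S S' hS hr _
    obtain ⟨q, u, v, -, rfl, rfl⟩ := hT'.adj _ _ hS
    have hq : toPt (q - z) ∈ Metric.closedBall x r := by
      have := hmem hr
      rw [mem_closedBall_iff_norm] at this ⊢
      rwa [toPt_sub, sub_sub, add_comm (toPt z)]
    rw [show x - (x + toPt z) = toPt (-z) by rw [toPt_neg]; abel, map_add_edge, map_add_edge,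
      ← sub_eq_add_neg]
    change T.rel (q - z) u v
    rw [hz _ (hbox _ hq), sub_add_cancel]
    exact hS

/-- A translation which maps a large enough part of the grid to the grid is integral. -/
lemma latt_of_grid {y : Pt 3} (h : ∀ q : Pt 3, ‖q‖ ≤ 3 → q + y ∈ grid → q ∈ grid) : latt y := by
  have key : ∀ i j : Fin 3, j ≠ i → ∃ m : ℤ, y j = m := by
    intro i
    obtain ⟨t, ht0, ht1, ht⟩ : ∃ t : ℝ, 0 ≤ t ∧ t ≤ 1 / 2 ∧
        ¬ ∃ m : ℤ, (round (y i) : ℝ) - y i + t = m := by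
      by_cases hy : ∃ m : ℤ, y i = m
      · obtain ⟨m, hm⟩ := hy
        refine ⟨1 / 2, by norm_num, le_rfl, ?_⟩
        rintro ⟨k, hk⟩
        rw [hm, round_intCast] at hk
        have h2 : (1 : ℝ) = ((2 * k : ℤ) : ℝ) := by push_cast; linarith
        have h3 : (1 : ℤ) = 2 * k := by exact_mod_cast h2
        omega
      · refine ⟨0, le_rfl, by norm_num, ?_⟩
        rintro ⟨k, hk⟩
        exact hy ⟨round (y i) - k, by push_cast; linarith⟩
    let a : Pt 3 := toPt fun j => round (y j)
    have hq : a + t • uvec 3 i - y ∈ grid := by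
      refine h _ ?_ ?_
      · refine (norm_le_of_coord (c := 1) zero_le_one fun j => ?_).trans (by norm_num)
        have h1 := abs_le.1 (abs_sub_round (y j))
        by_cases hj : j = i
        · subst hj
          simp only [a, uvec, toPt_apply, PiLp.sub_apply, PiLp.add_apply, PiLp.smul_apply,
            PiLp.single_apply, if_true, smul_eq_mul, mul_one]
          exact abs_le.2 ⟨by linarith, by linarith⟩
        · simp only [a, uvec, toPt_apply, PiLp.sub_apply, PiLp.add_apply, PiLp.smul_apply,
            PiLp.single_apply, if_neg hj, smul_eq_mul, mul_zero, add_zero]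
          exact abs_le.2 ⟨by linarith, by linarith⟩
      · rw [sub_add_cancel]
        exact ⟨i, fun j hj => ⟨round (y j), by simp [a, uvec, toPt_apply, hj]⟩⟩
    obtain ⟨k, hk⟩ := hq
    have hki : k = i := by
      by_contra hne
      obtain ⟨m, hm⟩ := hk i (Ne.symm hne)
      refine ht ⟨m, ?_⟩
      rw [← hm]
      simp [a, uvec, toPt_apply]
      ring
    subst hki
    intro j hj
    obtain ⟨m, hm⟩ := hk j hj
    simp only [a, uvec, toPt_apply, PiLp.sub_apply, PiLp.add_apply, PiLp.smul_apply,
      PiLp.single_apply, if_neg hj, smul_eq_mul, mul_zero, add_zero] at hm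
    exact ⟨round (y j) - m, by push_cast; linarith⟩
  intro j
  by_cases hj : j = 0
  · exact key 1 j (by rw [hj]; decide)
  · exact key 0 j hj

/-- A segment containing the midpoint of another segment coincides with it. -/
lemma eq_of_midpoint_mem {S : Sym2 (Pt 3)} (hS : IsSeg S) {p : Z3} {i : Fin 3}
    (h : toPt p + (1 / 2 : ℝ) • uvec 3 i ∈ segPts S) : S = s(toPt p, toPt p + uvec 3 i) := by
  obtain ⟨x, k, hx, rfl⟩ := hS
  obtain ⟨q, rfl⟩ := latt_iff.1 hx
  obtain ⟨t, h0, h1, ht⟩ : ∃ t : ℝ, 0 ≤ t ∧ t ≤ 1 ∧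
      toPt p + (1 / 2 : ℝ) • uvec 3 i = toPt q + t • uvec 3 k := by
    obtain ⟨a, b, hab, t, h0, h1, ht⟩ := h
    rcases Sym2.eq_iff.1 hab with ⟨rfl, rfl⟩ | ⟨rfl, rfl⟩
    · exact ⟨t, h0, h1, by rw [ht, add_sub_cancel_left]⟩
    · refine ⟨1 - t, by linarith, by linarith, ?_⟩
      rw [ht, sub_smul, one_smul, sub_add_cancel_left, smul_neg]
      abel
  have hc : ∀ j, (p j : ℝ) + (if j = i then 1 / 2 else 0) = q j + (if j = k then t else 0) := by
    intro j
    have := congrArg (fun w : Pt 3 => w j) ht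
    simpa [uvec, toPt_apply, PiLp.single_apply] using this
  have hik : i = k := by
    by_contra hne
    have := hc i
    rw [if_pos rfl, if_neg hne] at this
    have h2 : (1 : ℝ) = ((2 * (q i - p i) : ℤ) : ℝ) := by push_cast; linarith
    have h3 : (1 : ℤ) = 2 * (q i - p i) := by exact_mod_cast h2
    omega
  subst hik
  have hpq : p = q := by
    funext j
    have := hc j
    by_cases hj : j = i
    · rw [if_pos hj, if_pos hj] at this
      have h2 : (p j : ℝ) < (q j + 1 : ℤ) := by push_cast; linarith
      have h3 : (q j : ℝ) < (p j + 1 : ℤ) := by push_cast; linarith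
      have h4 : p j < q j + 1 := by exact_mod_cast h2
      have h5 : q j < p j + 1 := by exact_mod_cast h3
      omega
    · rw [if_neg hj, if_neg hj, add_zero, add_zero] at this
      exact_mod_cast this
  rw [hpq]

lemma full_and_locSub {T T' : Trace 3} (hseg : ∀ S ∈ T.segs, IsSeg S)
    (hadj : ∀ S S', T.conn S S' → ∃ p u v, u ≠ v ∧ S = edge p u ∧ S' = edge p v)
    (hT' : T'.Full) (h : ∀ r : ℝ, 0 ≤ r → ∃ y, BallIso T 0 T' y r) :
    T.Full ∧ LocSub T.rel T'.rel := by
  replace h : ∀ r : ℝ, 3 ≤ r → ∃ z, BallIso T 0 T' (toPt z) r := by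
    intro r hr
    obtain ⟨y, hy⟩ := h r (by linarith)
    have hl : latt y := by
      refine latt_of_grid fun q hq hqy => ?_
      have h1 : q + y ∈ T'.pts ∩ Metric.closedBall y r :=
        ⟨hT'.pts_eq ▸ hqy, by rw [mem_closedBall_iff_norm]; simpa using hq.trans hr⟩
      rw [← hy.1] at h1
      obtain ⟨q', ⟨hq', -⟩, he⟩ := h1
      simp only [sub_zero, add_left_inj] at he
      exact pts_subset_grid hseg (he ▸ hq')
    obtain ⟨z, rfl⟩ := latt_iff.1 hl
    exact ⟨z, hy⟩
  refine ⟨⟨?_, hadj⟩, fun N => ?_⟩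
  · refine Subset.antisymm hseg ?_
    rintro S ⟨x, i, hx, rfl⟩
    obtain ⟨p, rfl⟩ := latt_iff.1 hx
    set m : Pt 3 := toPt p + (1 / 2 : ℝ) • uvec 3 i with hm
    have hmg : m ∈ grid :=
      segPts_subset_grid ⟨toPt p, i, hx, rfl⟩ ⟨_, _, rfl, 1 / 2, by norm_num, by norm_num, by
        rw [add_sub_cancel_left]⟩
    obtain ⟨z, hz⟩ := h (max 3 ‖m‖) (le_max_left _ _)
    have h1 : m + toPt z ∈ T'.pts ∩ Metric.closedBall (toPt z) (max 3 ‖m‖) :=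
      ⟨hT'.pts_eq ▸ add_mem_grid hmg z, by rw [mem_closedBall_iff_norm]; simp⟩
    rw [← hz.1] at h1
    obtain ⟨q', ⟨hq', -⟩, he⟩ := h1
    simp only [sub_zero, add_left_inj] at he
    rw [he] at hq'
    obtain ⟨S, hS, hmS⟩ := mem_iUnion₂.1 hq'
    rwa [← eq_of_midpoint_mem (hseg S hS) hmS]
  · obtain ⟨z, hz⟩ := h (2 * (N + 1) + 1) (by have := N.cast_nonneg (α := ℝ); linarith)
    refine ⟨z, fun p hp => ?_⟩
    have hball : ∀ (c : Z3) (u : D6),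
        segPts (edge (p + c) u) ⊆ Metric.closedBall (toPt c) (2 * (N + 1) + 1) := by
      intro c u
      have hco : ∀ i, |(dvec u i : ℝ)| ≤ 1 := fun i => by
        rcases u with ⟨k, _ | _⟩ <;> by_cases hik : i = k <;> simp [dvec, hik]
      have hpo : ∀ i, |(p i : ℝ)| ≤ N := fun i => by exact_mod_cast hp i
      refine segPts_subset_of_convex (convex_closedBall _ _) ?_ ?_
      · rw [mem_closedBall_iff_norm, ← toPt_sub, add_sub_cancel_right]
        refine (norm_le_of_coord (c := N + 1) (by positivity) fun i => ?_).trans (by linarith)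
        rw [toPt_apply]
        linarith [hpo i]
      · rw [mem_closedBall_iff_norm, ← toPt_sub, add_right_comm, add_sub_cancel_right]
        refine (norm_le_of_coord (c := N + 1) (by positivity) fun i => ?_).trans (by linarith)
        rw [toPt_apply, Pi.add_apply, Int.cast_add]
        exact (abs_add_le _ _).trans (add_le_add (hpo i) (hco i))
    have hball0 : ∀ u, segPts (edge p u) ⊆ Metric.closedBall 0 (2 * (N + 1) + 1) := fun u => by
      simpa [toPt_zero] using hball 0 u
    funext u v
    refine propext ⟨fun huv => ?_, fun huv => ?_⟩
    · have := hz.2.1 _ _ huv (hball0 u) (hball0 v)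
      rwa [sub_zero, map_add_edge, map_add_edge] at this
    · have := hz.2.2 _ _ huv (hball z u) (hball z v)
      rwa [zero_sub, ← toPt_neg, map_add_edge, map_add_edge, add_neg_cancel_right] at this

/-- Theorem 2.8: for `R` satisfying (P), a set of curves `ℰ` is locally
isomorphic to `Ĉ_R` iff either `ℰ ≅ Ĉ_S` for a pairing relation `S` satisfying (P), or
`ℰ ≅ Ĉ_X` for a sequence `X = (x_s)` with `x_{s+1} - x_s ∈ 2^{s+1}ℤ³` and
`⋂_{s ∈ ℕ*} (x_s + 2^{s+1}ℤ³) = ∅`. -/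
theorem statement15 (C3 : Set (Curve 3)) (hC3 : traceOf C3 = CTrace)
    (hH : SatH C3 2 4) (P : ℕ → Set (Curve 3)) (hP : PowersOf C3 2 P)
    (R : Pt 3 → Pt 3 → Prop) (hR : IsPairing R) (hRP : SatP P R)
    (E : Set (Curve 3)) :
    LocallyIso (traceOf E) (hatRTrace P R) ↔
      ((∃ S : Pt 3 → Pt 3 → Prop, IsPairing S ∧ SatP P S ∧
          ∃ t : Pt 3, latt t ∧ Trace.transl t (hatRTrace P S) = traceOf E) ∨
       (∃ x : ℕ → Pt 3, (∀ s : ℕ, 1 ≤ s → latt (x s)) ∧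
          (∀ s : ℕ, 1 ≤ s → inLat (2 ^ (s + 1)) (x (s + 1) - x s)) ∧
          (¬ ∃ p : Pt 3, ∀ s : ℕ, 1 ≤ s → inLat (2 ^ (s + 1)) (p - x s)) ∧
          ∃ t : Pt 3, latt t ∧ Trace.transl t (hatXTrace P x) = traceOf E)) := by
  have hQ := tower_powers hC3 hH hP
  have hTR := hatRTrace_full hH hP hR
  have hRF := (satP_iff hH hP hR.2.1).1 hRP
  have locallyIso : ∀ {T : Trace 3}, T.Full →
      Finitary (fun s => (traceOf (P s)).rel) T.rel →
      Containing (fun s => (traceOf (P s)).rel) T.rel → Functional T.rel →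
      LocallyIso T (hatRTrace P R) := by
    intro T hT hfin hcont hfun
    have hrel := rel_hatRTrace (P := P) hR
    refine ⟨fun x r _ => hT.exists_ballIso hTR ?_ x r, fun y r _ => hTR.exists_ballIso hT ?_ y r⟩
    · rw [hrel]
      exact hQ.locSub hfin (Tower.hatR_containing _) (hQ.hatR_func hRF)
    · rw [hrel]
      exact hQ.locSub (hQ.hatR_finitary hRF) hcont hfun
  constructor
  · rintro ⟨h, -⟩
    obtain ⟨hE, hsub⟩ := full_and_locSub (T := traceOf E)
      (fun S ⟨c, _, hS⟩ => c.isSeg_of_mem hS) (fun _ _ => traceOf_conn_adj) hTR (h 0)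
    rw [rel_hatRTrace hR] at hsub
    rcases hQ.classify hRF hsub with ⟨S, t, hS, hF⟩ | ⟨x, hx, hx0, hF⟩
    · obtain ⟨hfun, hfull, hsymm, hirr⟩ := hQ.satPF_spec hS
      have hpair := isPairing_onDirs hfun hfull hsymm hirr
      have hTS := hatRTrace_full hH hP hpair
      refine Or.inl ⟨onDirs S, hpair, (satP_iff hH hP hpair.2.1).2 (by rwa [onLabels_onDirs]),
        toPt t, latt_toPt t, (hTS.transl t).ext hE ?_⟩
      funext p
      rw [Trace.rel_transl hTS.adj, rel_hatRTrace hpair, onLabels_onDirs, hF]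
    · have hTX := hatXTrace_full hH hP (x := fun s => toPt (x s)) fun _ _ => rfl
      refine Or.inr ⟨fun s => toPt (x s), fun s _ => latt_toPt _, fun s hs => ?_, ?_,
        toPt 0, latt_toPt 0, (hTX.transl 0).ext hE ?_⟩
      · rw [← toPt_sub, inLat_toPt]
        exact_mod_cast hx s hs
      · rintro ⟨p, hp⟩
        have hpl : latt p := by
          obtain ⟨q, hq, -⟩ := toPt_mulOf (hp 1 le_rfl)
          rw [sub_eq_iff_eq_add, ← toPt_add] at hq
          exact hq ▸ latt_toPt _
        obtain ⟨q, rfl⟩ := latt_iff.1 hpl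
        obtain ⟨s, hs, hn⟩ := hx0 q
        have := hp s hs
        rw [← toPt_sub, inLat_toPt] at this
        exact hn (by exact_mod_cast this)
      · funext p
        rw [Trace.rel_transl hTX.adj, rel_hatXTrace (x' := x) fun _ _ => rfl, sub_zero, hF]
  · rintro (⟨S, hS, hSP, t, ht, hE⟩ | ⟨x, hxl, hx, hx0, t, ht, hE⟩)
    · obtain ⟨t, rfl⟩ := latt_iff.1 ht
      have hTS := hatRTrace_full hH hP hS
      have hSF := (satP_iff hH hP hS.2.1).1 hSP
      have hrel : (Trace.transl (toPt t) (hatRTrace P S)).rel =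
          fun p => hatRF (fun s => (traceOf (P s)).rel) (onLabels S) (p - t) := by
        funext p
        rw [Trace.rel_transl hTS.adj, rel_hatRTrace hS]
      rw [← hE]
      refine locallyIso (hTS.transl t) ?_ ?_ ?_ <;> rw [hrel]
      · exact (hQ.hatR_finitary hSF).shift t
      · exact (Tower.hatR_containing _).shift t
      · exact fun p => hQ.hatR_func hSF (p - t)
    · obtain ⟨t, rfl⟩ := latt_iff.1 ht
      choose! x' hx' using fun s hs => latt_iff.1 (hxl s hs)
      have hTX := hatXTrace_full hH hP hx'
      have hrel : (Trace.transl (toPt t) (hatXTrace P x)).rel =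
          fun p => hatXF (fun s => (traceOf (P s)).rel) x' (p - t) := by
        funext p
        rw [Trace.rel_transl hTX.adj, rel_hatXTrace hx']
      have hstep : ∀ s, 1 ≤ s → MulOf (2 ^ (s + 1)) (x' (s + 1) - x' s) := by
        intro s hs
        have := hx s hs
        rw [hx' s hs, hx' (s + 1) (by omega), ← toPt_sub, inLat_toPt] at this
        exact_mod_cast this
      have hempty : ∀ p, ∃ s, 1 ≤ s ∧ ¬ MulOf (2 ^ (s + 1)) (p - x' s) := by
        by_contra! hp
        obtain ⟨p, hp⟩ := hp
        refine hx0 ⟨toPt p, fun s hs => ?_⟩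
        rw [hx' s hs, ← toPt_sub, inLat_toPt]
        exact_mod_cast hp s hs
      rw [← hE]
      refine locallyIso (hTX.transl t) ?_ ?_ ?_ <;> rw [hrel]
      · exact (hQ.hatX_finitary hstep hempty).shift t
      · exact (hQ.hatX_containing).shift t
      · exact fun p => hQ.hatX_func hstep (p - t)

end
end Folding
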